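/- Let n ≥ 19 be a natural number. For every prime power q satisfying gcd(q^3 − q, n) ≠ 1, there exists a primitive 2-normal element in F_{q^n} over F_q. -/

import Mathlib

open Polynomial

noncomputable section

/-- An element of a finite field is *primitive* if it generates the cyclic multiplicative
group, i.e. its multiplicative order is `card E - 1`. -/
def IsPrimitiveElem {E : Type*} [Field E] [Fintype E] (α : E) : Prop :=
  orderOf α = Fintype.card E - 1

/-- The polynomial `g_α(x) = Σ_{i=0}^{n-1} α^{q^i} x^{n-1-i} ∈ F_{q^n}[x]`. -/
def gPoly {E : Type*} [Field E] (q n : ℕ) (α : E) : Polynomial E :=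
  ∑ i ∈ Finset.range n, C (α ^ q ^ i) * X ^ (n - 1 - i)

/-- `α ∈ F_{q^n}` is `k`-normal over `F_q` if `gcd(x^n - 1, g_α(x))` in `F_{q^n}[x]`
has degree `k`. -/
def IsKNormal {E : Type*} [Field E] (q n k : ℕ) (α : E) : Prop :=
  (@EuclideanDomain.gcd (Polynomial E) _ (Classical.decEq _)
    ((X : Polynomial E) ^ n - 1) (gPoly q n α)).natDegree = k

section CharacterSums

variable {E : Type*} [Field E] [Fintype E]

lemma norm_gaussSum_le {χ : MulChar E ℂ} (hχ : χ ≠ 1) (ψ : AddChar E ℂ) :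
    ‖gaussSum χ ψ‖ ≤ √(Fintype.card E) := by
  rcases eq_or_ne ψ 1 with rfl | hψ
  · simp [gaussSum_one_right hχ]
  · have h := gaussSum_mul_gaussSum_eq_card hχ (AddChar.IsPrimitive.of_ne_one hψ)
    rw [← star_gaussSum_eq] at h
    have h2 := congrArg norm h
    rw [norm_mul, norm_star, Complex.norm_natCast, ← sq] at h2
    exact Real.le_sqrt_of_sq_le h2.le

lemma norm_sum_mulChar_ker_le {χ : MulChar E ℂ} (hχ : χ ≠ 1) (M : E →+ E) [DecidableEq E] :
    ‖∑ α with M α = 0, χ α‖ ≤ √(Fintype.card E) := by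
  have hQ : (0 : ℝ) < Fintype.card E := by exact_mod_cast Fintype.card_pos
  have key : (Fintype.card E : ℂ) * ∑ α with M α = 0, χ α
      = ∑ ψ : AddChar E ℂ, gaussSum χ (ψ.compAddMonoidHom M) := by
    simp only [gaussSum, AddChar.compAddMonoidHom_apply]
    rw [Finset.sum_comm]
    simp_rw [← Finset.mul_sum, AddChar.sum_apply_eq_ite, Finset.sum_filter, Finset.mul_sum]
    refine Finset.sum_congr rfl fun α _ ↦ ?_
    split_ifs <;> ring
  have h2 : (Fintype.card E : ℝ) * ‖∑ α with M α = 0, χ α‖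
      ≤ Fintype.card E * √(Fintype.card E) := by
    calc _ = ‖(Fintype.card E : ℂ) * ∑ α with M α = 0, χ α‖ := by
            rw [norm_mul, Complex.norm_natCast]
      _ ≤ ∑ ψ : AddChar E ℂ, √(Fintype.card E) := by
            rw [key]
            exact (norm_sum_le _ _).trans (Finset.sum_le_sum fun ψ _ ↦ norm_gaussSum_le hχ _)
      _ = _ := by
            rw [Finset.sum_const, nsmul_eq_mul, Finset.card_univ, AddChar.card_eq]
  exact le_of_mul_le_mul_left h2 hQ

lemma mulChar_apply_eq_one_iff {χ : MulChar E ℂ} {d : ℕ} (hχ : orderOf χ = d)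
    (hd : d ∣ Fintype.card E - 1) {α : E} (hα : α ≠ 0) :
    χ α = 1 ↔ α ^ ((Fintype.card E - 1) / d) = 1 := by
  classical
  have hQ : 0 < Fintype.card E - 1 := Nat.sub_pos_of_lt Fintype.one_lt_card
  obtain ⟨e, he⟩ := hd
  have hd0 : 0 < d := Nat.pos_of_mul_pos_right (he ▸ hQ)
  rw [he, Nat.mul_div_cancel_left _ hd0]
  have he0 : 0 < e := Nat.pos_of_mul_pos_left (he ▸ hQ)
  obtain ⟨g, hg⟩ := IsCyclic.exists_zpow_surjective (G := Eˣ)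
  have hg' : ∀ x : Eˣ, ∃ k : ℕ, g ^ k = x := fun x ↦ by
    have hx : x ∈ Submonoid.powers g :=
      mem_powers_iff_mem_zpowers.2 (by obtain ⟨k, hk⟩ := hg x; exact ⟨k, hk⟩)
    exact hx
  have hog : orderOf g = d * e := by
    rw [← he, ← Fintype.card_units, ← Nat.card_eq_fintype_card]
    exact orderOf_eq_card_of_forall_mem_zpowers fun x ↦ by
      obtain ⟨k, hk⟩ := hg x; exact ⟨k, hk⟩
  obtain ⟨k, hk⟩ := hg' (Units.mk0 α hα)
  have hα' : α = (g : E) ^ k := by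
    have := congrArg Units.val hk
    simpa using this.symm
  have h1 : α ^ e = 1 ↔ d ∣ k := by
    rw [hα', ← pow_mul, ← Units.val_pow_eq_pow_val, Units.val_eq_one, ← orderOf_dvd_iff_pow_eq_one,
      hog]
    exact Nat.mul_dvd_mul_iff_right he0
  have h2 : χ α = 1 ↔ d ∣ k := by
    rw [hα', map_pow]
    constructor
    · intro h
      rw [← hχ, orderOf_dvd_iff_pow_eq_one]
      ext x
      obtain ⟨j, rfl⟩ := hg' x
      rw [MulChar.pow_apply_coe, MulChar.one_apply_coe, Units.val_pow_eq_pow_val, map_pow,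
        ← pow_mul, mul_comm, pow_mul, h, one_pow]
    · rintro ⟨j, rfl⟩
      rw [pow_mul, ← MulChar.pow_apply_coe, ← hχ, pow_orderOf_eq_one, MulChar.one_apply_coe,
        one_pow]
  rw [h1, h2]

open scoped Classical in
/-- The number of nonzero `d`-th powers in the kernel of an additive map. -/
lemma abs_card_ker_pow_sub_le (M : E →+ E) {d : ℕ} (hd : d ∣ Fintype.card E - 1) :
    |((Finset.univ.filter fun α : E ↦
        α ≠ 0 ∧ M α = 0 ∧ α ^ ((Fintype.card E - 1) / d) = 1).card : ℝ)
      - (Finset.univ.filter fun α : E ↦ M α = 0).card / d| ≤ √(Fintype.card E) := by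
  have hQ : 0 < Fintype.card E - 1 := Nat.sub_pos_of_lt Fintype.one_lt_card
  have hd0 : 0 < d := Nat.pos_of_dvd_of_pos hd hQ
  obtain ⟨χ, hχ⟩ := MulChar.exists_mulChar_orderOf E hd (Complex.isPrimitiveRoot_exp d hd0.ne')
  set N := (Finset.univ.filter fun α : E ↦
        α ≠ 0 ∧ M α = 0 ∧ α ^ ((Fintype.card E - 1) / d) = 1).card with hN
  set U := (Finset.univ.filter fun α : E ↦ M α = 0).card with hU
  have h1 : ∀ α : E, ∑ j ∈ Finset.range d, (χ ^ j) α
      = if α ≠ 0 ∧ α ^ ((Fintype.card E - 1) / d) = 1 then (d : ℂ) else 0 := by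
    intro α
    rcases eq_or_ne α 0 with rfl | hα
    · simp [MulChar.map_zero]
    · have hpow : ∀ j : ℕ, (χ ^ j) α = χ α ^ j := fun j ↦ by
        simpa using MulChar.pow_apply_coe χ j (Units.mk0 α hα)
      simp_rw [hpow]
      by_cases h : χ α = 1
      · simp [h, hα, (mulChar_apply_eq_one_iff hχ hd hα).1 h]
      · rw [if_neg fun h' ↦ h ((mulChar_apply_eq_one_iff hχ hd hα).2 h'.2)]
        have := mul_neg_geom_sum (χ α) d
        rw [← hpow d, ← hχ, pow_orderOf_eq_one, ← Units.val_mk0 hα, MulChar.one_apply_coe,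
          sub_self, Units.val_mk0, hχ] at this
        exact (mul_eq_zero.1 this).resolve_left (sub_ne_zero.2 (Ne.symm h))
  have h2 : (d : ℂ) * N = ∑ j ∈ Finset.range d, ∑ α with M α = 0, (χ ^ j) α := by
    rw [Finset.sum_comm]
    simp_rw [h1]
    rw [← Finset.sum_filter, Finset.filter_filter, Finset.sum_const, nsmul_eq_mul, mul_comm, hN]
    congr 3
    ext α
    simp only [Finset.mem_filter, Finset.mem_univ, true_and]
    tauto
  obtain ⟨d', rfl⟩ : ∃ d', d = d' + 1 := ⟨d - 1, by omega⟩
  rw [Finset.sum_range_succ'] at h2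
  have h3 : ∑ α with M α = 0, (χ ^ 0) α = (U : ℂ) - 1 := by
    rw [pow_zero, hU]
    have h0 : (0 : E) ∈ Finset.univ.filter fun α : E ↦ M α = 0 := by simp
    rw [← Finset.sum_erase_add _ _ h0, MulChar.map_zero, add_zero,
      Finset.sum_congr rfl (g := fun _ ↦ (1 : ℂ)), Finset.sum_const, Finset.card_erase_of_mem h0,
      nsmul_eq_mul, mul_one, Nat.cast_sub (Finset.card_pos.2 ⟨_, h0⟩), Nat.cast_one]
    intro x hx
    exact MulChar.one_apply (Ne.isUnit (Finset.ne_of_mem_erase hx))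
  rw [h3] at h2
  have hs1 : (1 : ℝ) ≤ √(Fintype.card E) := by
    rw [Real.one_le_sqrt]; exact_mod_cast Fintype.card_pos
  have h4 : ‖((d' + 1 : ℕ) : ℂ) * N - U‖ ≤ ((d' + 1 : ℕ) : ℝ) * √(Fintype.card E) := by
    have : ((d' + 1 : ℕ) : ℂ) * N - U
        = ∑ j ∈ Finset.range d', ∑ α with M α = 0, (χ ^ (j + 1)) α - 1 := by rw [h2]; ring
    rw [this]
    calc _ ≤ ‖∑ j ∈ Finset.range d', ∑ α with M α = 0, (χ ^ (j + 1)) α‖ + ‖(1 : ℂ)‖ :=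
          norm_sub_le _ _
      _ ≤ ∑ j ∈ Finset.range d', √(Fintype.card E) + √(Fintype.card E) := by
          refine add_le_add ((norm_sum_le _ _).trans (Finset.sum_le_sum fun j hj ↦ ?_)) (by rw [norm_one]; exact hs1)
          refine norm_sum_mulChar_ker_le (fun h ↦ ?_) M
          have := orderOf_dvd_of_pow_eq_one h
          rw [hχ] at this
          have := Nat.le_of_dvd (by omega) this
          have := Finset.mem_range.1 hj
          omega
      _ = _ := by rw [Finset.sum_const, Finset.card_range, nsmul_eq_mul]; push_cast; ring
  have h5 : |((d' + 1 : ℕ) : ℝ) * N - U| ≤ ((d' + 1 : ℕ) : ℝ) * √(Fintype.card E) := by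
    rw [← Real.norm_eq_abs, ← Complex.norm_real]
    simpa using h4
  have hd' : (0 : ℝ) < ((d' + 1 : ℕ) : ℝ) := by positivity
  have h6 : (N : ℝ) - U / ((d' + 1 : ℕ) : ℝ)
      = (((d' + 1 : ℕ) : ℝ) * N - U) / ((d' + 1 : ℕ) : ℝ) := by field_simp
  rw [h6, abs_div, abs_of_pos hd', div_le_iff₀ hd']
  linarith

end CharacterSums

section Sieve

open scoped Classical in
lemma abs_card_avoid_sub_le {Ω ι : Type*} (U : Finset Ω) (A : ι → Ω → Prop) (w : ι → ℝ)
    (Y R : ℝ) (C : Finset ι)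
    (h : ∀ T ⊆ C, |((U.filter fun α ↦ ∀ i ∈ T, A i α).card : ℝ) - Y * ∏ i ∈ T, w i| ≤ R) :
    |((U.filter fun α ↦ ∀ i ∈ C, ¬ A i α).card : ℝ) - Y * ∏ i ∈ C, (1 - w i)|
      ≤ 2 ^ C.card * R := by
  have h1 : ((U.filter fun α ↦ ∀ i ∈ C, ¬ A i α).card : ℝ)
      = ∑ T ∈ C.powerset, (-1) ^ T.card * ((U.filter fun α ↦ ∀ i ∈ T, A i α).card : ℝ) := by
    have h2 (α : Ω) : (if ∀ i ∈ C, ¬ A i α then (1 : ℝ) else 0)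
        = ∑ T ∈ C.powerset, (-1) ^ T.card * (if ∀ i ∈ T, A i α then (1 : ℝ) else 0) := by
      have h3 : (if ∀ i ∈ C, ¬ A i α then (1 : ℝ) else 0)
          = ∏ i ∈ C, (1 + -(if A i α then (1 : ℝ) else 0)) := by
        split_ifs with h0
        · exact (Finset.prod_eq_one fun i hi ↦ by simp [h0 i hi]).symm
        · push Not at h0
          obtain ⟨i, hi, hA⟩ := h0
          exact (Finset.prod_eq_zero hi (by simp [hA])).symm
      rw [h3, Finset.prod_one_add]
      refine Finset.sum_congr rfl fun T _ ↦ ?_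
      rw [Finset.prod_neg]
      congr 1
      split_ifs with h0
      · exact Finset.prod_eq_one fun i hi ↦ by simp [h0 i hi]
      · push Not at h0
        obtain ⟨i, hi, hA⟩ := h0
        exact Finset.prod_eq_zero hi (by simp [hA])
    simp_rw [Finset.card_filter, Nat.cast_sum, Nat.cast_ite, Nat.cast_one, Nat.cast_zero]
    rw [Finset.sum_congr rfl fun α _ ↦ h2 α, Finset.sum_comm]
    simp_rw [Finset.mul_sum]
  have h4 : Y * ∏ i ∈ C, (1 - w i)
      = ∑ T ∈ C.powerset, (-1) ^ T.card * (Y * ∏ i ∈ T, w i) := by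
    simp_rw [sub_eq_add_neg]
    rw [Finset.prod_one_add, Finset.mul_sum]
    refine Finset.sum_congr rfl fun T _ ↦ ?_
    rw [Finset.prod_neg]
    ring
  rw [h1, h4, ← Finset.sum_sub_distrib]
  refine (Finset.abs_sum_le_sum_abs _ _).trans ?_
  have h5 : (2 : ℝ) ^ C.card * R = C.powerset.card • R := by simp
  rw [h5]
  refine Finset.sum_le_card_nsmul _ _ _ fun T hT ↦ ?_
  rw [← mul_sub, abs_mul, abs_pow, abs_neg, abs_one, one_pow, one_mul]
  exact h T (Finset.mem_powerset.1 hT)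

open scoped Classical in
lemma exists_avoid_of_sieve {Ω ι : Type*} (U : Finset Ω) (A : ι → Ω → Prop) (w : ι → ℝ)
    (Y R : ℝ) (C S : Finset ι) (hCS : Disjoint C S)
    (h : ∀ T : Finset ι, (∀ i ∈ T, i ∈ C ∨ i ∈ S) →
      |((U.filter fun α ↦ ∀ i ∈ T, A i α).card : ℝ) - Y * ∏ i ∈ T, w i| ≤ R)
    (hlt : 2 ^ C.card * (S.card + 1) * R < Y * (∏ i ∈ C, (1 - w i)) * (1 - ∑ j ∈ S, w j)) :
    ∃ α ∈ U, ∀ i, i ∈ C ∨ i ∈ S → ¬ A i α := by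
  by_contra! hno
  have h0 := abs_card_avoid_sub_le U A w Y R C
    fun T hT ↦ h T fun i hi ↦ Or.inl (hT hi)
  have hj : ∀ j ∈ S, (((U.filter fun α ↦ A j α).filter fun α ↦ ∀ i ∈ C, ¬ A i α).card : ℝ)
      ≤ Y * (∏ i ∈ C, (1 - w i)) * w j + 2 ^ C.card * R := by
    intro j hjS
    have h1 := abs_card_avoid_sub_le (U.filter fun α ↦ A j α) A w (Y * w j) R C fun T hT ↦ by
      have hjT : j ∉ T := fun h' ↦ Finset.disjoint_left.1 hCS (hT h') hjS
      have h2 := h (insert j T) fun i hi ↦ (Finset.mem_insert.1 hi).elim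
        (fun hij ↦ Or.inr (hij ▸ hjS)) fun hi ↦ Or.inl (hT hi)
      rw [Finset.prod_insert hjT, ← mul_assoc] at h2
      rw [Finset.filter_filter]
      simpa using h2
    have := (abs_le.1 h1).2
    linarith
  have hsub : (U.filter fun α ↦ ∀ i ∈ C, ¬ A i α) ⊆
      S.biUnion fun j ↦ (U.filter fun α ↦ A j α).filter fun α ↦ ∀ i ∈ C, ¬ A i α := by
    intro α hα
    obtain ⟨hU, hC⟩ := Finset.mem_filter.1 hα
    obtain ⟨i, hi, hA⟩ := hno α hU
    rcases hi with hi | hi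
    · exact absurd hA (hC i hi)
    · exact Finset.mem_biUnion.2 ⟨i, hi, by simp [hU, hA]; exact hC⟩
  have h5 : ((U.filter fun α ↦ ∀ i ∈ C, ¬ A i α).card : ℝ)
      ≤ ∑ j ∈ S, (Y * (∏ i ∈ C, (1 - w i)) * w j + 2 ^ C.card * R) := by
    refine le_trans ?_ (Finset.sum_le_sum hj)
    exact_mod_cast (Finset.card_le_card hsub).trans Finset.card_biUnion_le
  rw [Finset.sum_add_distrib, ← Finset.mul_sum, Finset.sum_const, nsmul_eq_mul] at h5
  have := (abs_le.1 h0).1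
  linarith

end Sieve

section Linearized

variable {E : Type*} [Field E]

/-- The value at `x` of the `q`-linearized polynomial associated with `v`. -/
def linEval (q : ℕ) (v : E[X]) (x : E) : E :=
  ∑ j ∈ Finset.range (v.natDegree + 1), v.coeff j * x ^ q ^ j

lemma card_le_of_linEval_eq_zero {q : ℕ} (hq : 1 < q) {v : E[X]} (hv : v ≠ 0) (S : Finset E)
    (hS : ∀ x ∈ S, linEval q v x = 0) : S.card ≤ q ^ v.natDegree := by
  set P : E[X] := ∑ j ∈ Finset.range (v.natDegree + 1), C (v.coeff j) * X ^ q ^ j with hP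
  have hdeg : P.natDegree ≤ q ^ v.natDegree := by
    refine natDegree_sum_le_of_forall_le _ _ fun j hj ↦ (natDegree_C_mul_X_pow_le _ _).trans ?_
    exact Nat.pow_le_pow_right hq.le (Nat.lt_succ_iff.1 (Finset.mem_range.1 hj))
  have hP0 : P ≠ 0 := by
    intro h0
    have h1 : P.coeff (q ^ v.natDegree) = v.leadingCoeff := by
      rw [hP, finsetSum_coeff, Finset.sum_eq_single v.natDegree]
      · simp
      · intro j _ hj
        rw [coeff_C_mul_X_pow, if_neg fun h ↦ hj (Nat.pow_right_injective hq h).symm]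
      · simp
    rw [h0, coeff_zero] at h1
    exact hv (leadingCoeff_eq_zero.1 h1.symm)
  have hsub : S.val ⊆ P.roots := by
    intro x hx
    rw [mem_roots hP0, IsRoot, hP, eval_finsetSum]
    simpa [linEval] using hS x hx
  exact (card_le_degree_of_subset_roots hsub).trans hdeg

end Linearized

section FrobeniusModule

variable (K E : Type*) [Field K] [Fintype K] [Field E] [Fintype E] [Algebra K E]

/-- The action of polynomials over `K` on `E`, the indeterminate acting as Frobenius. -/
def frobAct : K[X] →ₐ[K] Module.End K E :=
  aeval (FiniteField.frobeniusAlgHom K E).toLinearMap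

variable {K E}

lemma frobAct_X (x : E) : frobAct K E X x = x ^ Fintype.card K := by
  simp [frobAct]

lemma frobAct_mul_apply (f g : K[X]) (x : E) :
    frobAct K E (f * g) x = frobAct K E f (frobAct K E g x) := by
  rw [map_mul]; rfl

lemma frobAct_X_pow (j : ℕ) (x : E) : frobAct K E (X ^ j) x = x ^ Fintype.card K ^ j := by
  induction j with
  | zero => simp
  | succ j ih => rw [pow_succ', frobAct_mul_apply, ih, frobAct_X, ← pow_mul, ← pow_succ]

lemma frobAct_apply_eq_linEval (f : K[X]) (x : E) :
    frobAct K E f x = linEval (Fintype.card K) (f.map (algebraMap K E)) x := by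
  rw [linEval, natDegree_map]
  conv_lhs => rw [f.as_sum_range_C_mul_X_pow]
  rw [map_sum, LinearMap.sum_apply]
  refine Finset.sum_congr rfl fun j _ ↦ ?_
  rw [frobAct_mul_apply, frobAct_X_pow, coeff_map, ← Algebra.smul_def,
    show frobAct K E (C (f.coeff j)) = algebraMap K _ (f.coeff j) from aeval_C _ _]
  rfl

lemma frobAct_X_pow_finrank_sub_one : frobAct K E (X ^ Module.finrank K E - 1) = 0 := by
  rw [← FiniteField.minpoly_frobeniusAlgHom]
  exact minpoly.aeval _ _

lemma frobAct_apply_eq_zero_of_dvd {f g : K[X]} (hfg : f ∣ g) {x : E}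
    (h : frobAct K E f x = 0) : frobAct K E g x = 0 := by
  obtain ⟨c, rfl⟩ := hfg
  rw [mul_comm, frobAct_mul_apply, h, map_zero]

lemma finrank_ker_frobAct_le {f : K[X]} (hf : f ≠ 0) :
    Module.finrank K (LinearMap.ker (frobAct K E f)) ≤ f.natDegree := by
  classical
  have h1 := card_le_of_linEval_eq_zero (E := E) (Fintype.one_lt_card (α := K))
    ((Polynomial.map_ne_zero_iff (algebraMap K E).injective).2 hf)
    (Finset.univ.filter fun x ↦ frobAct K E f x = 0)
    fun x hx ↦ by rw [← frobAct_apply_eq_linEval]; exact (Finset.mem_filter.1 hx).2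
  have h2 : (Finset.univ.filter fun x ↦ frobAct K E f x = 0).card
      = Fintype.card (LinearMap.ker (frobAct K E f)) := by
    rw [← Fintype.card_subtype]; rfl
  rw [h2, Module.card_eq_pow_finrank (K := K), natDegree_map] at h1
  exact (Nat.pow_le_pow_iff_right Fintype.one_lt_card).1 h1

open scoped Classical in
lemma card_ker_frobAct {f : K[X]} (hf : f ∣ X ^ Module.finrank K E - 1) :
    (Finset.univ.filter fun x ↦ frobAct K E f x = 0).card
      = Fintype.card K ^ f.natDegree := by
  obtain ⟨r, hr⟩ := hf
  have hn : 0 < Module.finrank K E := Module.finrank_pos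
  have hne : (X ^ Module.finrank K E - 1 : K[X]) ≠ 0 := (monic_X_pow_sub_C 1 hn.ne').ne_zero
  have hf0 : f ≠ 0 := fun h ↦ hne (by rw [hr, h, zero_mul])
  have hr0 : r ≠ 0 := fun h ↦ hne (by rw [hr, h, mul_zero])
  have hdeg : f.natDegree + r.natDegree = Module.finrank K E := by
    rw [← natDegree_mul hf0 hr0, ← hr]; exact natDegree_X_pow_sub_C
  have h1 := finrank_ker_frobAct_le (E := E) hf0
  have h2 := finrank_ker_frobAct_le (E := E) hr0
  have h3 := LinearMap.finrank_range_add_finrank_ker (frobAct K E f)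
  have h4 : LinearMap.range (frobAct K E f) ≤ LinearMap.ker (frobAct K E r) := by
    rintro _ ⟨x, rfl⟩
    rw [LinearMap.mem_ker, ← frobAct_mul_apply, mul_comm, ← hr, frobAct_X_pow_finrank_sub_one]
    rfl
  have h5 := Submodule.finrank_mono h4
  have h6 : (Finset.univ.filter fun x ↦ frobAct K E f x = 0).card
      = Fintype.card (LinearMap.ker (frobAct K E f)) := by
    rw [← Fintype.card_subtype]; rfl
  rw [h6, Module.card_eq_pow_finrank (K := K)]
  congr 1
  omega

lemma X_pow_mul_gPoly (j : ℕ) (x : E) :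
    (X ^ Module.finrank K E - 1 : E[X]) ∣
      X ^ j * gPoly (Fintype.card K) (Module.finrank K E) x
        - gPoly (Fintype.card K) (Module.finrank K E) (x ^ Fintype.card K ^ j) := by
  have hn : 0 < Module.finrank K E := Module.finrank_pos
  have hQ : Fintype.card E = Fintype.card K ^ Module.finrank K E := Module.card_eq_pow_finrank
  set q := Fintype.card K
  set n := Module.finrank K E
  have key (y : E) : X * gPoly q n y - gPoly q n (y ^ q) = C y * (X ^ n - 1) := by
    obtain ⟨m, hm⟩ : ∃ m, n = m + 1 := ⟨n - 1, by omega⟩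
    have hy : y ^ q ^ n = y := by rw [← hQ]; exact FiniteField.pow_card y
    unfold gPoly
    rw [hm, Finset.mul_sum, Finset.sum_range_succ', Finset.sum_range_succ]
    have h1 : ∑ k ∈ Finset.range m, X * (C (y ^ q ^ (k + 1)) * X ^ (m + 1 - 1 - (k + 1)))
        = ∑ k ∈ Finset.range m, (C ((y ^ q) ^ q ^ k) * X ^ (m + 1 - 1 - k) : E[X]) := by
      refine Finset.sum_congr rfl fun k hk ↦ ?_
      have := Finset.mem_range.1 hk
      rw [← pow_mul, ← pow_succ', show m + 1 - 1 - k = m + 1 - 1 - (k + 1) + 1 by omega]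
      ring
    rw [h1, ← pow_mul, ← pow_succ', ← hm, hy, hm]
    simp
    ring
  induction j with
  | zero => simp
  | succ j ih =>
    obtain ⟨c, hc⟩ := ih
    refine ⟨X * c + C (x ^ q ^ j), ?_⟩
    have := key (x ^ q ^ j)
    rw [← pow_mul, ← pow_succ] at this
    linear_combination X * hc + this

lemma X_pow_sub_one_dvd_mul_gPoly_iff (v : E[X]) (x : E) :
    (X ^ Module.finrank K E - 1 : E[X]) ∣ v * gPoly (Fintype.card K) (Module.finrank K E) x ↔
      ∀ i < Module.finrank K E, linEval (Fintype.card K) v (x ^ Fintype.card K ^ i) = 0 := by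
  have hX (j : ℕ) := X_pow_mul_gPoly (K := K) j x
  have hn : 0 < Module.finrank K E := Module.finrank_pos
  set q := Fintype.card K
  set n := Module.finrank K E
  set w : E[X] := ∑ i ∈ Finset.range n, C (linEval q v (x ^ q ^ i)) * X ^ (n - 1 - i) with hw
  have h1 : (X ^ n - 1 : E[X]) ∣ v * gPoly q n x - w := by
    have h2 : w = ∑ j ∈ Finset.range (v.natDegree + 1), C (v.coeff j) * gPoly q n (x ^ q ^ j) := by
      simp_rw [hw, linEval, gPoly, map_sum, Finset.sum_mul, Finset.mul_sum]
      rw [Finset.sum_comm]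
      refine Finset.sum_congr rfl fun j _ ↦ Finset.sum_congr rfl fun i _ ↦ ?_
      rw [C_mul, mul_assoc, ← pow_mul, ← pow_mul, mul_comm (q ^ i)]
    have h3 : v * gPoly q n x
        = ∑ j ∈ Finset.range (v.natDegree + 1), C (v.coeff j) * X ^ j * gPoly q n x := by
      rw [← Finset.sum_mul, ← v.as_sum_range_C_mul_X_pow]
    rw [h2, h3, ← Finset.sum_sub_distrib]
    refine Finset.dvd_sum fun j _ ↦ ?_
    rw [mul_assoc, ← mul_sub]
    exact (hX j).mul_left _
  rw [(dvd_iff_dvd_of_dvd_sub h1)]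
  have hmon : (X ^ n - 1 : E[X]).Monic := monic_X_pow_sub_C 1 hn.ne'
  have hdeg : w.degree < (X ^ n - 1 : E[X]).degree := by
    rw [show (X ^ n - 1 : E[X]).degree = n from degree_X_pow_sub_C hn 1]
    refine (degree_sum_le _ _).trans_lt ((Finset.sup_lt_iff (WithBot.bot_lt_coe _)).2 ?_)
    intro i _
    refine (degree_C_mul_X_pow_le _ _).trans_lt ?_
    exact_mod_cast (by omega : n - 1 - i < n)
  constructor
  · intro h i hi
    have hw0 : w = 0 := by
      by_contra hne
      exact not_lt_of_ge (degree_le_of_dvd h hne) hdeg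
    have h3 : w.coeff (n - 1 - i) = linEval q v (x ^ q ^ i) := by
      rw [hw, finsetSum_coeff, Finset.sum_eq_single i]
      · simp
      · intro j hj hji
        have := Finset.mem_range.1 hj
        rw [coeff_C_mul_X_pow, if_neg (by omega)]
      · intro h'
        exact absurd (Finset.mem_range.2 hi) h'
    rw [← h3, hw0, coeff_zero]
  · intro h
    rw [hw, Finset.sum_eq_zero fun i hi ↦ by rw [h i (Finset.mem_range.1 hi), C_0, zero_mul]]
    exact dvd_zero _

end FrobeniusModule

section TwoNormal

variable {K E : Type*} [Field K] [Fintype K] [Field E] [Fintype E] [Algebra K E]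

lemma dvd_of_frobAct_eq_zero {h : K[X]} (hh : h ≠ 0) {x : E} (hx : frobAct K E h x = 0)
    (hmin : ∀ g c : K[X], Irreducible g → h = g * c → frobAct K E c x ≠ 0)
    {f : K[X]} (hf : frobAct K E f x = 0) : h ∣ f := by
  classical
  have hgcd : frobAct K E (EuclideanDomain.gcd h f) x = 0 := by
    rw [EuclideanDomain.gcd_eq_gcd_ab, map_add, LinearMap.add_apply, mul_comm h, mul_comm f,
      frobAct_mul_apply, frobAct_mul_apply, hx, hf, map_zero, map_zero, add_zero]
  obtain ⟨c, hc⟩ := EuclideanDomain.gcd_dvd_left h f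
  by_cases hu : IsUnit c
  · have h1 : h ∣ EuclideanDomain.gcd h f :=
      hu.dvd_mul_right.1 (dvd_of_eq hc)
    exact h1.trans (EuclideanDomain.gcd_dvd_right h f)
  · have hc0 : c ≠ 0 := fun h0 ↦ hh (by rw [hc, h0, mul_zero])
    obtain ⟨g, hg, c', rfl⟩ := WfDvdMonoid.exists_irreducible_factor hu hc0
    refine absurd ?_ (hmin g (EuclideanDomain.gcd h f * c') hg ?_)
    · exact frobAct_apply_eq_zero_of_dvd (dvd_mul_right _ _) hgcd
    · conv_lhs => rw [hc]
      ring

lemma isKNormal_of_frobAct {h f : K[X]} (hhf : h * f = X ^ Module.finrank K E - 1)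
    {x : E} (hx : frobAct K E h x = 0)
    (hmin : ∀ g c : K[X], Irreducible g → h = g * c → frobAct K E c x ≠ 0) :
    IsKNormal (Fintype.card K) (Module.finrank K E) f.natDegree x := by
  classical
  have hiff := fun v : E[X] ↦ X_pow_sub_one_dvd_mul_gPoly_iff (K := K) v x
  have hn : 0 < Module.finrank K E := Module.finrank_pos
  have hne : (X ^ Module.finrank K E - 1 : K[X]) ≠ 0 := (monic_X_pow_sub_C 1 hn.ne').ne_zero
  have hneE : (X ^ Module.finrank K E - 1 : E[X]) ≠ 0 := (monic_X_pow_sub_C 1 hn.ne').ne_zero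
  have hh0 : h ≠ 0 := fun h' ↦ hne (by rw [← hhf, h', zero_mul])
  have hf0 : f ≠ 0 := fun h' ↦ hne (by rw [← hhf, h', mul_zero])
  have hdeg : h.natDegree + f.natDegree = Module.finrank K E := by
    rw [← natDegree_mul hh0 hf0, hhf]; exact natDegree_X_pow_sub_C
  unfold IsKNormal
  set n := Module.finrank K E
  set q := Fintype.card K
  set u := @EuclideanDomain.gcd (Polynomial E) _ (Classical.decEq _) (X ^ n - 1) (gPoly q n x)
    with hu
  obtain ⟨v, huv⟩ : u ∣ X ^ n - 1 :=
    @EuclideanDomain.gcd_dvd_left _ _ (Classical.decEq _) _ _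
  obtain ⟨w, huw⟩ : u ∣ gPoly q n x :=
    @EuclideanDomain.gcd_dvd_right _ _ (Classical.decEq _) _ _
  have hu0 : u ≠ 0 := fun h' ↦ hneE (by rw [huv, h', zero_mul])
  have hv0 : v ≠ 0 := fun h' ↦ hneE (by rw [huv, h', mul_zero])
  have hdegE : u.natDegree + v.natDegree = n := by
    rw [← natDegree_mul hu0 hv0, ← huv]; exact natDegree_X_pow_sub_C
  have hmap : h.map (algebraMap K E) * f.map (algebraMap K E) = X ^ n - 1 := by
    rw [← Polynomial.map_mul, hhf]; simp
  refine le_antisymm ?_ ?_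
  · have h1 : ∀ i < n, linEval q v (x ^ q ^ i) = 0 := by
      rw [← hiff v, huv, huw]
      exact ⟨w, by ring⟩
    let F : (Fin h.natDegree → K) → E := fun c ↦ ∑ i, c i • x ^ q ^ (i : ℕ)
    have hF (c : Fin h.natDegree → K) :
        F c = frobAct K E (∑ i : Fin h.natDegree, C (c i) * X ^ (i : ℕ)) x := by
      rw [map_sum, LinearMap.sum_apply]
      refine Finset.sum_congr rfl fun i _ ↦ ?_
      rw [frobAct_mul_apply, frobAct_X_pow,
        show frobAct K E (C (c i)) = algebraMap K _ (c i) from aeval_C _ _]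
      rfl
    have hinj : Function.Injective F := by
      intro c c' hcc
      rw [hF, hF, ← sub_eq_zero, ← LinearMap.sub_apply, ← map_sub] at hcc
      have h2 := dvd_of_frobAct_eq_zero hh0 hx hmin hcc
      rw [← Finset.sum_sub_distrib] at h2
      simp_rw [← sub_mul, ← C_sub] at h2
      have h3 := eq_zero_of_dvd_of_degree_lt h2 ?_
      · funext i
        have h4 := congrArg (fun p ↦ coeff p (i : ℕ)) h3
        simp only [finsetSum_coeff, coeff_C_mul_X_pow, coeff_zero] at h4
        rw [Finset.sum_eq_single i] at h4
        · simpa [sub_eq_zero] using h4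
        · intro j _ hji
          rw [if_neg fun h' ↦ hji (Fin.ext h'.symm)]
        · simp
      · rw [degree_eq_natDegree hh0]
        refine (degree_sum_le _ _).trans_lt ((Finset.sup_lt_iff (WithBot.bot_lt_coe _)).2 ?_)
        intro i _
        refine (degree_C_mul_X_pow_le _ _).trans_lt ?_
        exact_mod_cast i.2
    have h5 : ∀ y ∈ Finset.univ.image F, linEval q v y = 0 := by
      intro y hy
      obtain ⟨c, -, rfl⟩ := Finset.mem_image.1 hy
      let Lv : E →ₗ[K] E := ∑ j ∈ Finset.range (v.natDegree + 1),
        LinearMap.mulLeft K (v.coeff j) ∘ₗ frobAct K E (X ^ j)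
      have hLv (y : E) : Lv y = linEval q v y := by
        simp only [Lv, linEval, LinearMap.sum_apply, LinearMap.comp_apply, frobAct_X_pow]
        rfl
      rw [← hLv, map_sum]
      refine Finset.sum_eq_zero fun i _ ↦ ?_
      rw [map_smul, hLv, h1 i (by omega), smul_zero]
    have h6 := card_le_of_linEval_eq_zero Fintype.one_lt_card hv0 _ h5
    rw [Finset.card_image_of_injective _ hinj, Finset.card_univ, Fintype.card_fun,
      Fintype.card_fin] at h6
    have := (Nat.pow_le_pow_iff_right Fintype.one_lt_card).1 h6
    omega
  · have h1 : (X ^ n - 1 : E[X]) ∣ h.map (algebraMap K E) * gPoly q n x := by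
      rw [hiff]
      intro i _
      rw [← frobAct_apply_eq_linEval, ← frobAct_X_pow, ← frobAct_mul_apply, mul_comm,
        frobAct_mul_apply, hx, map_zero]
    rw [← hmap] at h1
    have h2 := (mul_dvd_mul_iff_left ((Polynomial.map_ne_zero_iff
      (algebraMap K E).injective).2 hh0)).1 h1
    have h3 : f.map (algebraMap K E) ∣ u :=
      @EuclideanDomain.dvd_gcd _ _ (Classical.decEq _) _ _ _ (hmap ▸ dvd_mul_left _ _) h2
    rw [← natDegree_map (algebraMap K E)]
    exact natDegree_le_of_dvd h3 hu0

end TwoNormal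

section Criterion

variable {K E : Type*} [Field K] [Fintype K] [Field E] [Fintype E] [Algebra K E]

lemma frobAct_eq_zero_of_forall_mem {h : K[X]} {x : E} (hx : frobAct K E h x = 0)
    (T : Finset K[X]) (hT : ∀ g ∈ T, g.Monic ∧ Irreducible g) :
    ∀ c, h = (∏ g ∈ T, g) * c → (∀ g ∈ T, ∀ d, h = g * d → frobAct K E d x = 0) →
      frobAct K E c x = 0 := by
  classical
  induction T using Finset.induction_on with
  | empty =>
    intro c hc _
    rw [Finset.prod_empty, one_mul] at hc
    rwa [← hc]
  | insert g T hg ih =>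
    intro c hc hall
    rw [Finset.prod_insert hg] at hc
    have h1 : frobAct K E (g * c) x = 0 :=
      ih (fun g' hg' ↦ hT g' (Finset.mem_insert_of_mem hg')) (g * c) (by rw [hc]; ring)
        fun g' hg' ↦ hall g' (Finset.mem_insert_of_mem hg')
    have h2 : frobAct K E ((∏ g ∈ T, g) * c) x = 0 :=
      hall g (Finset.mem_insert_self _ _) _ (by rw [hc]; ring)
    have hcop : IsCoprime g (∏ g ∈ T, g) := by
      refine IsCoprime.prod_right fun g' hg' ↦ ?_
      have hi := hT g (Finset.mem_insert_self _ _)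
      have hi' := hT g' (Finset.mem_insert_of_mem hg')
      rw [hi.2.coprime_iff_not_dvd]
      intro hd
      have := eq_of_monic_of_associated hi.1 hi'.1 (hi.2.associated_of_dvd hi'.2 hd)
      exact hg (this ▸ hg')
    obtain ⟨a, b, hab⟩ := hcop
    have h3 : c = a * (g * c) + b * ((∏ g ∈ T, g) * c) := by linear_combination (-c) * hab
    rw [h3, map_add, LinearMap.add_apply, frobAct_mul_apply, frobAct_mul_apply b, h1, h2,
      map_zero, map_zero, add_zero]

lemma pow_div_prod_eq_one {α : E} (hα : α ≠ 0) (T : Finset ℕ)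
    (hT : ∀ p ∈ T, p.Prime ∧ p ∣ Fintype.card E - 1) :
    α ^ ((Fintype.card E - 1) / ∏ p ∈ T, p) = 1 ↔
      ∀ p ∈ T, α ^ ((Fintype.card E - 1) / p) = 1 := by
  have hdvd : ∏ p ∈ T, p ∣ Fintype.card E - 1 :=
    Finset.prod_primes_dvd _ (fun p hp ↦ (hT p hp).1.prime) fun p hp ↦ (hT p hp).2
  have hQ : 0 < Fintype.card E - 1 := Nat.sub_pos_of_lt Fintype.one_lt_card
  obtain ⟨e, he⟩ := orderOf_dvd_of_pow_eq_one (FiniteField.pow_card_sub_one_eq_one α hα)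
  have ho : 0 < orderOf α := Nat.pos_of_mul_pos_right (he ▸ hQ)
  have key {d : ℕ} (hd : d ∣ Fintype.card E - 1) :
      α ^ ((Fintype.card E - 1) / d) = 1 ↔ d ∣ e := by
    obtain ⟨c, hc⟩ := hd
    have hd0 : 0 < d := Nat.pos_of_mul_pos_right (hc ▸ hQ)
    rw [← orderOf_dvd_iff_pow_eq_one, hc, Nat.mul_div_cancel_left _ hd0]
    have h1 : orderOf α * e = d * c := he ▸ hc
    constructor
    · rintro ⟨k, rfl⟩
      refine ⟨k, Nat.eq_of_mul_eq_mul_left ho ?_⟩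
      rw [h1]; ring
    · rintro ⟨k, rfl⟩
      refine ⟨k, Nat.eq_of_mul_eq_mul_left hd0 ?_⟩
      rw [← h1]; ring
  rw [key hdvd]
  constructor
  · intro h p hp
    exact (key (hT p hp).2).2 ((Finset.dvd_prod_of_mem _ hp).trans h)
  · intro h
    exact Finset.prod_primes_dvd _ (fun p hp ↦ (hT p hp).1.prime)
      fun p hp ↦ (key (hT p hp).2).1 (h p hp)

open UniqueFactorizationMonoid in
open scoped Classical in
lemma exists_primitive_kNormal_of_sieve {h f : K[X]} (hhf : h * f = X ^ Module.finrank K E - 1)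
    (D D' : Finset ℕ) (G G' : Finset K[X]) (hD : Disjoint D D') (hG : Disjoint G G')
    (hDD' : D ∪ D' = (Fintype.card E - 1).primeFactors)
    (hGG' : G ∪ G' = (normalizedFactors h).toFinset)
    (hlt : 2 ^ (D.card + G.card) * (D'.card + G'.card + 1) * √(Fintype.card E) <
      (Fintype.card K : ℝ) ^ h.natDegree * ((∏ p ∈ D, (1 - 1 / (p : ℝ))) *
        ∏ g ∈ G, (1 - 1 / (Fintype.card K : ℝ) ^ g.natDegree)) *
        (1 - (∑ p ∈ D', 1 / (p : ℝ) + ∑ g ∈ G', 1 / (Fintype.card K : ℝ) ^ g.natDegree))) :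
    ∃ α : E, IsPrimitiveElem α ∧
      IsKNormal (Fintype.card K) (Module.finrank K E) f.natDegree α := by
  have hn : 0 < Module.finrank K E := Module.finrank_pos
  have hne : (X ^ Module.finrank K E - 1 : K[X]) ≠ 0 := (monic_X_pow_sub_C 1 hn.ne').ne_zero
  have hh0 : h ≠ 0 := fun h' ↦ hne (by rw [← hhf, h', zero_mul])
  have hQ : 0 < Fintype.card E - 1 := Nat.sub_pos_of_lt Fintype.one_lt_card
  have hq0 : (Fintype.card K : ℝ) ≠ 0 := by exact_mod_cast Fintype.card_ne_zero
  have hmemG {g : K[X]} : g ∈ G ∪ G' ↔ g.Monic ∧ Irreducible g ∧ g ∣ h := by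
    rw [hGG', Multiset.mem_toFinset, Polynomial.mem_normalizedFactors_iff hh0]
    tauto
  have hmemD {p : ℕ} : p ∈ D ∪ D' ↔ p.Prime ∧ p ∣ Fintype.card E - 1 := by
    rw [hDD', Nat.mem_primeFactors]
    exact ⟨fun h ↦ ⟨h.1, h.2.1⟩, fun h ↦ ⟨h.1, h.2, hQ.ne'⟩⟩
  let A : ℕ ⊕ K[X] → E → Prop := Sum.elim (fun p α ↦ α ^ ((Fintype.card E - 1) / p) = 1)
    fun g α ↦ ∀ c, h = g * c → frobAct K E c α = 0
  let w : ℕ ⊕ K[X] → ℝ := Sum.elim (fun p ↦ 1 / (p : ℝ))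
    fun g ↦ 1 / (Fintype.card K : ℝ) ^ g.natDegree
  have hunion (i : ℕ ⊕ K[X]) : (i ∈ D.disjSum G ∨ i ∈ D'.disjSum G') ↔
      i ∈ (D ∪ D').disjSum (G ∪ G') := by
    rcases i with x | x <;> simp
  obtain ⟨α, hαU, hα⟩ := exists_avoid_of_sieve
    (Finset.univ.filter fun α : E ↦ α ≠ 0 ∧ frobAct K E h α = 0) A w
    ((Fintype.card K : ℝ) ^ h.natDegree) (√(Fintype.card E)) (D.disjSum G) (D'.disjSum G')
    (by
      rw [Finset.disjoint_left]
      rintro (x | x) hx hx'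
      · exact Finset.disjoint_left.1 hD (Finset.inl_mem_disjSum.1 hx)
          (Finset.inl_mem_disjSum.1 hx')
      · exact Finset.disjoint_left.1 hG (Finset.inr_mem_disjSum.1 hx)
          (Finset.inr_mem_disjSum.1 hx'))
    (by
      intro T hT
      simp only [hunion] at hT
      have hl : ∀ p ∈ T.toLeft, p.Prime ∧ p ∣ Fintype.card E - 1 := fun p hp ↦
        hmemD.1 (Finset.inl_mem_disjSum.1 (hT _ (Finset.mem_toLeft.1 hp)))
      have hr : ∀ g ∈ T.toRight, g.Monic ∧ Irreducible g ∧ g ∣ h := fun g hg ↦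
        hmemG.1 (Finset.inr_mem_disjSum.1 (hT _ (Finset.mem_toRight.1 hg)))
      have hdvd : ∏ p ∈ T.toLeft, p ∣ Fintype.card E - 1 :=
        Finset.prod_primes_dvd _ (fun p hp ↦ (hl p hp).1.prime) fun p hp ↦ (hl p hp).2
      obtain ⟨c, hc⟩ : ∏ g ∈ T.toRight, g ∣ h := by
        refine Finset.prod_dvd_of_coprime (fun g hg g' hg' hgg' ↦ ?_) fun g hg ↦ (hr g hg).2.2
        show IsCoprime g g'
        have hi := hr g hg
        have hi' := hr g' hg'
        rw [hi.2.1.coprime_iff_not_dvd]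
        exact fun hd ↦ hgg'
          (eq_of_monic_of_associated hi.1 hi'.1 (hi.2.1.associated_of_dvd hi'.2.1 hd))
      have hc0 : c ≠ 0 := fun h' ↦ hh0 (by rw [hc, h', mul_zero])
      have hcount := abs_card_ker_pow_sub_le (frobAct K E c).toAddMonoidHom hdvd
      have hcd : c ∣ X ^ Module.finrank K E - 1 := by
        rw [← hhf, hc]; exact ((dvd_mul_left _ _).mul_right _)
      have hker := card_ker_frobAct hcd
      rw [show (Finset.univ.filter fun x ↦ (frobAct K E c).toAddMonoidHom x = 0).card
        = Fintype.card K ^ c.natDegree by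
          rw [← hker]; congr 1] at hcount
      have hval : (Fintype.card K : ℝ) ^ h.natDegree * ∏ i ∈ T, w i
          = ((Fintype.card K ^ c.natDegree : ℕ) : ℝ) / ((∏ p ∈ T.toLeft, p : ℕ) : ℝ) := by
        rw [← T.toLeft_disjSum_toRight, Finset.prod_disjSum]
        simp only [Finset.toLeft_disjSum, w, Sum.elim_inl, Sum.elim_inr, Finset.prod_div_distrib,
          Finset.prod_const_one]
        rw [Finset.prod_pow_eq_pow_sum,
          ← natDegree_prod_of_monic _ _ fun g hg ↦ (hr g hg).1]
        have : h.natDegree = (∏ g ∈ T.toRight, g).natDegree + c.natDegree := by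
          rw [← natDegree_mul (Finset.prod_ne_zero_iff.2 fun g hg ↦ (hr g hg).1.ne_zero) hc0,
            ← hc]
        rw [this, pow_add]
        push_cast
        field_simp
      rw [hval]
      convert hcount using 5
      rw [Finset.filter_filter]
      refine Finset.filter_congr fun α _ ↦ ?_
      constructor
      · rintro ⟨⟨h0, hk⟩, hall⟩
        refine ⟨h0, ?_, (pow_div_prod_eq_one h0 _ hl).2 fun p hp ↦
          hall (Sum.inl p) (Finset.mem_toLeft.1 hp)⟩
        exact frobAct_eq_zero_of_forall_mem hk _ (fun g hg ↦ ⟨(hr g hg).1, (hr g hg).2.1⟩) c hc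
          fun g hg ↦ hall (Sum.inr g) (Finset.mem_toRight.1 hg)
      · rintro ⟨h0, hk, hp1⟩
        refine ⟨⟨h0, frobAct_apply_eq_zero_of_dvd (hc ▸ dvd_mul_left _ _) hk⟩, ?_⟩
        rintro (p | g) hi
        · exact (pow_div_prod_eq_one h0 _ hl).1 hp1 p (Finset.mem_toLeft.2 hi)
        · intro d hd
          have hg := hr g (Finset.mem_toRight.2 hi)
          refine frobAct_apply_eq_zero_of_dvd ⟨∏ g ∈ T.toRight.erase g, g, ?_⟩ hk
          apply mul_left_cancel₀ hg.1.ne_zero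
          rw [← hd]
          conv_lhs => rw [hc]
          rw [← Finset.mul_prod_erase _ _ (Finset.mem_toRight.2 hi)]
          ring)
    (by
      rw [Finset.card_disjSum, Finset.card_disjSum, Finset.prod_disjSum, Finset.sum_disjSum]
      push_cast
      exact hlt)
  obtain ⟨h0, hk⟩ := (Finset.mem_filter.1 hαU).2
  simp only [hunion] at hα
  refine ⟨α, ?_, isKNormal_of_frobAct hhf hk ?_⟩
  · refine orderOf_eq_of_pow_and_pow_div_prime hQ (FiniteField.pow_card_sub_one_eq_one α h0) ?_
    intro p hp hpd
    exact hα (Sum.inl p) (Finset.inl_mem_disjSum.2 (hmemD.2 ⟨hp, hpd⟩))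
  · intro g c hg hgc hzero
    have hg0 : g.leadingCoeff ≠ 0 := leadingCoeff_ne_zero.2 hg.ne_zero
    have hass : Associated g (normalize g) := (normalize_associated g).symm
    refine hα (Sum.inr (normalize g)) (Finset.inr_mem_disjSum.2 (hmemG.2
      ⟨monic_normalize hg.ne_zero, hass.irreducible hg, hass.dvd_iff_dvd_left.1 ⟨c, hgc⟩⟩)) ?_
    intro d hd
    refine frobAct_apply_eq_zero_of_dvd ?_ hzero
    have h1 : g * c ∣ g * d := by
      rw [← hgc, hd]
      exact mul_dvd_mul_right hass.symm.dvd d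
    exact (mul_dvd_mul_iff_left hg.ne_zero).1 h1

end Criterion

lemma exists_subfield_of_card {q n : ℕ} (hq : IsPrimePow q)
    (E : Type*) [Field E] [Fintype E] (hE : Fintype.card E = q ^ n) :
    ∃ (K : Type) (_ : Field K) (_ : Fintype K) (_ : Algebra K E),
      Fintype.card K = q ∧ Module.finrank K E = n := by
  obtain ⟨p, k, hp, hk, rfl⟩ := (isPrimePow_nat_iff q).1 hq
  have : Fact p.Prime := ⟨hp⟩
  obtain ⟨r, hr⟩ := CharP.exists E
  obtain ⟨m, hrp, hm⟩ := FiniteField.card E r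
  have hrp' : r = p := by
    have h1 : r ∣ (p ^ k) ^ n := by rw [← hE, hm]; exact dvd_pow_self _ m.ne_zero
    exact (Nat.prime_dvd_prime_iff_eq hrp hp).1
      (hrp.dvd_of_dvd_pow (hrp.dvd_of_dvd_pow h1))
  subst hrp'
  let := ZMod.algebra E r
  have h1 : Module.finrank (ZMod r) E = k * n := by
    have h2 := Module.card_eq_pow_finrank (K := ZMod r) (V := E)
    rw [hE, ZMod.card, ← pow_mul] at h2
    exact (Nat.pow_right_injective hrp.two_le h2).symm
  obtain ⟨φ⟩ := FiniteField.nonempty_algHom_of_finrank_dvd (F := ZMod r) (K := GaloisField r k)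
    (L := E) (by rw [GaloisField.finrank r hk.ne', h1]; exact dvd_mul_right _ _)
  let : Algebra (GaloisField r k) E := φ.toRingHom.toAlgebra
  let : Fintype (GaloisField r k) := Fintype.ofFinite _
  have h3 : Fintype.card (GaloisField r k) = r ^ k := by
    rw [Fintype.card_eq_nat_card, GaloisField.card r k hk.ne']
  refine ⟨GaloisField r k, inferInstance, inferInstance, inferInstance, h3, ?_⟩
  have h4 := Module.card_eq_pow_finrank (K := GaloisField r k) (V := E)
  rw [hE, h3] at h4
  exact (Nat.pow_right_injective (Nat.one_lt_pow hk.ne' hrp.one_lt) h4).symm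

section Factors

variable {K : Type*} [Field K]

lemma X_pow_sub_one_dvd_X_pow_sub_one {a b : ℕ} (h : a ∣ b) : (X ^ a - 1 : K[X]) ∣ X ^ b - 1 := by
  obtain ⟨c, rfl⟩ := h
  rw [pow_mul]
  simpa using sub_dvd_pow_sub_pow (X ^ a : K[X]) 1 c

lemma dvd_X_pow_gcd_sub_one {g : K[X]} {a b : ℕ} (ha : g ∣ X ^ a - 1) (hb : g ∣ X ^ b - 1) :
    g ∣ X ^ a.gcd b - 1 := by
  rw [← Ideal.mem_span_singleton, ← Ideal.Quotient.eq_zero_iff_mem, map_sub, map_pow, map_one,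
    sub_eq_zero, ← orderOf_dvd_iff_pow_eq_one] at *
  exact Nat.dvd_gcd ha hb

lemma sum_natDegree_le_of_dvd (G : Finset K[X]) (hG : ∀ g ∈ G, g.Monic ∧ Irreducible g)
    {P : K[X]} (hP : P ≠ 0) (hGP : ∀ g ∈ G, g ∣ P) : ∑ g ∈ G, g.natDegree ≤ P.natDegree := by
  rw [← natDegree_prod_of_monic _ _ fun g hg ↦ (hG g hg).1]
  refine natDegree_le_of_dvd (Finset.prod_dvd_of_coprime (fun g hg g' hg' hgg' ↦ ?_) hGP) hP
  show IsCoprime g g'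
  rw [(hG g hg).2.coprime_iff_not_dvd]
  exact fun hd ↦ hgg' (eq_of_monic_of_associated (hG g hg).1 (hG g' hg').1
    ((hG g hg).2.associated_of_dvd (hG g' hg').2 hd))

variable [Fintype K]

lemma exists_monic_quadratic_dvd {n : ℕ}
    (hgcd : Nat.gcd (Fintype.card K ^ 3 - Fintype.card K) n ≠ 1) :
    ∃ f : K[X], f.Monic ∧ f.natDegree = 2 ∧ f ∣ X ^ n - 1 := by
  obtain ⟨r, hr, hrd⟩ := Nat.exists_prime_and_dvd hgcd
  have hrn : r ∣ n := hrd.trans (Nat.gcd_dvd_right _ _)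
  have hrq : r ∣ Fintype.card K * (Fintype.card K ^ 2 - 1) := by
    rw [Nat.mul_sub, mul_one, ← pow_succ']; exact hrd.trans (Nat.gcd_dvd_left _ _)
  suffices h : ∃ f : K[X], f.Monic ∧ f.natDegree = 2 ∧ f ∣ X ^ r - 1 by
    obtain ⟨f, h1, h2, h3⟩ := h
    exact ⟨f, h1, h2, h3.trans (X_pow_sub_one_dvd_X_pow_sub_one hrn)⟩
  have hX1 : (X - 1 : K[X]).Monic := monic_X_sub_C 1
  have hX1d : (X - 1 : K[X]).natDegree = 1 := natDegree_X_sub_C 1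
  rcases (hr.dvd_mul).1 hrq with h | h
  · obtain ⟨p, hp⟩ := CharP.exists K
    obtain ⟨m, hpp, hm⟩ := FiniteField.card K p
    have hrp : r = p := (Nat.prime_dvd_prime_iff_eq hr hpp).1 (hr.dvd_of_dvd_pow (hm ▸ h))
    subst hrp
    have : Fact r.Prime := ⟨hr⟩
    refine ⟨(X - 1) ^ 2, hX1.pow 2, by rw [hX1.natDegree_pow, hX1d], ?_⟩
    have := sub_pow_char (X : K[X]) 1 (p := r)
    rw [one_pow] at this
    rw [← this]
    exact pow_dvd_pow _ hr.two_le
  · set c : K[X] := ∑ i ∈ Finset.range r, X ^ i with hc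
    have hc1 : c * (X - 1) = X ^ r - 1 := geom_sum_mul X r
    have hne : (X ^ r - 1 : K[X]) ≠ 0 := (monic_X_pow_sub_C 1 hr.ne_zero).ne_zero
    have hc0 : c ≠ 0 := fun h0 ↦ hne (by rw [← hc1, h0, zero_mul])
    have hcd : c.natDegree + 1 = r := by
      rw [← hX1d, ← natDegree_mul hc0 hX1.ne_zero, hc1]; exact natDegree_X_pow_sub_C
    have hcu : ¬ IsUnit c := fun hu ↦ by
      have := natDegree_eq_zero_of_isUnit hu
      have := hr.two_le
      omega
    obtain ⟨π, hπm, hπ, hπc⟩ := exists_monic_irreducible_factor c hcu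
    have hπr : π ∣ X ^ r - 1 := hπc.trans (hc1 ▸ dvd_mul_right _ _)
    have hdeg : π.natDegree ∣ 2 := by
      rw [hπ.natDegree_dvd_iff_dvd_X_pow_card_pow_sub_X]
      have h1 : (X ^ Nat.card K ^ 2 - X : K[X]) = X * (X ^ (Fintype.card K ^ 2 - 1) - 1) := by
        rw [mul_sub, mul_one, ← pow_succ', Nat.card_eq_fintype_card,
          Nat.sub_add_cancel (Nat.one_le_pow _ _ Fintype.card_pos)]
      rw [h1]
      exact (hπr.trans (X_pow_sub_one_dvd_X_pow_sub_one h)).mul_left _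
    rcases (Nat.dvd_prime Nat.prime_two).1 hdeg with h1 | h1
    · refine ⟨π * (X - 1), hπm.mul hX1, by rw [hπm.natDegree_mul hX1, h1, hX1d], ?_⟩
      rw [← hc1]
      exact mul_dvd_mul_right hπc _
    · exact ⟨π, hπm, h1, hπr⟩

lemma dvd_X_pow_card_pow_sub_one {g : K[X]} (hg : Irreducible g) {n : ℕ} (hn : n ≠ 0)
    (hgn : g ∣ X ^ n - 1) : g ∣ X ^ (Fintype.card K ^ g.natDegree - 1) - 1 := by
  have h1 := hg.natDegree_dvd_iff_dvd_X_pow_card_pow_sub_X.1 (dvd_refl g.natDegree)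
  have h2 : (X ^ Nat.card K ^ g.natDegree - X : K[X])
      = X * (X ^ (Fintype.card K ^ g.natDegree - 1) - 1) := by
    rw [mul_sub, mul_one, ← pow_succ', Nat.card_eq_fintype_card,
      Nat.sub_add_cancel (Nat.one_le_pow _ _ Fintype.card_pos)]
  rw [h2] at h1
  refine (hg.prime.dvd_or_dvd h1).resolve_left fun hX ↦ hg.not_isUnit ?_
  have h3 : g ∣ 1 := by
    have := dvd_sub (hX.trans (dvd_pow_self X hn)) hgn
    simpa using this
  exact isUnit_of_dvd_one h3

lemma card_filter_natDegree_eq_mul_le (G : Finset K[X]) (hG : ∀ g ∈ G, g.Monic ∧ Irreducible g)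
    {n : ℕ} (hn : n ≠ 0) (hGn : ∀ g ∈ G, g ∣ X ^ n - 1) {d : ℕ} (hd : d ≠ 0) :
    (G.filter fun g ↦ g.natDegree = d).card * d ≤ n.gcd (Fintype.card K ^ d - 1) := by
  have hpos : n.gcd (Fintype.card K ^ d - 1) ≠ 0 := (Nat.gcd_pos_of_pos_left _ (by omega)).ne'
  have h1 := sum_natDegree_le_of_dvd (G.filter fun g ↦ g.natDegree = d)
    (fun g hg ↦ hG g (Finset.mem_filter.1 hg).1)
    (P := X ^ n.gcd (Fintype.card K ^ d - 1) - 1) (monic_X_pow_sub_C 1 hpos).ne_zero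
    (fun g hg ↦ by
      obtain ⟨hgG, hgd⟩ := Finset.mem_filter.1 hg
      have := dvd_X_pow_card_pow_sub_one (hG g hgG).2 hn (hGn g hgG)
      rw [hgd] at this
      exact dvd_X_pow_gcd_sub_one (hGn g hgG) this)
  rw [show (X ^ n.gcd (Fintype.card K ^ d - 1) - 1 : K[X]).natDegree
    = n.gcd (Fintype.card K ^ d - 1) from natDegree_X_pow_sub_C,
    Finset.sum_congr rfl fun g hg ↦ (Finset.mem_filter.1 hg).2] at h1
  simpa using h1

end Factors

/-- The factor contributed to the error term of the sieve by an irreducible polynomial of degree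
`d` over a field with `q` elements. -/
def polyCost (q d : ℕ) : ℝ := 2 * (q : ℝ) ^ d / ((q : ℝ) ^ d - 1)

/-- The factor contributed to the error term of the sieve by a prime `p`. -/
def primeCost (p : ℕ) : ℝ := 2 * (p : ℝ) / ((p : ℝ) - 1)

section Cost

lemma pow_cast_sub_one_pos {q d : ℕ} (hq : 1 < q) (hd : d ≠ 0) : (0 : ℝ) < (q : ℝ) ^ d - 1 :=
  sub_pos.2 (one_lt_pow₀ (by exact_mod_cast hq) hd)

lemma one_le_polyCost {q d : ℕ} (hq : 1 < q) (hd : d ≠ 0) : 1 ≤ polyCost q d := by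
  have := pow_cast_sub_one_pos hq hd
  rw [polyCost, one_le_div this]
  linarith

lemma polyCost_anti {q d e : ℕ} (hq : 1 < q) (hd : d ≠ 0) (hde : d ≤ e) :
    polyCost q e ≤ polyCost q d := by
  have h1 := pow_cast_sub_one_pos hq hd
  have h2 := pow_cast_sub_one_pos hq (show e ≠ 0 by omega)
  have h3 : (q : ℝ) ^ d ≤ (q : ℝ) ^ e := pow_le_pow_right₀ (by exact_mod_cast hq.le) hde
  rw [polyCost, polyCost, div_le_div_iff₀ h2 h1]
  nlinarith

lemma primeCost_pos {p : ℕ} (hp : 1 < p) : 0 < primeCost p := by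
  have : (1 : ℝ) < p := by exact_mod_cast hp
  exact div_pos (by linarith) (by linarith)

lemma prod_comp_le_prod_pow {ι : Type*} (S : Finset ι) (δ : ι → ℕ) (I : Finset ℕ) (a : ℕ → ℕ)
    (F : ℕ → ℝ) (hF : ∀ d ∈ I, 1 ≤ F d) (hδ : ∀ g ∈ S, δ g ∈ I)
    (ha : ∀ d ∈ I, (S.filter fun g ↦ δ g = d).card ≤ a d) :
    ∏ g ∈ S, F (δ g) ≤ ∏ d ∈ I, F d ^ a d := by
  rw [← Finset.prod_fiberwise_of_maps_to hδ]
  refine Finset.prod_le_prod (fun d hd ↦ Finset.prod_nonneg fun g hg ↦ ?_) fun d hd ↦ ?_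
  · rw [(Finset.mem_filter.1 hg).2]; exact zero_le_one.trans (hF d hd)
  · rw [Finset.prod_congr rfl (g := fun _ ↦ F d) fun g hg ↦ by rw [(Finset.mem_filter.1 hg).2],
      Finset.prod_const]
    exact pow_le_pow_right₀ (hF d hd) (ha d hd)

lemma sum_comp_le_sum_mul {ι : Type*} (S : Finset ι) (δ : ι → ℕ) (I : Finset ℕ) (a : ℕ → ℕ)
    (F : ℕ → ℝ) (hF : ∀ d ∈ I, 0 ≤ F d) (hδ : ∀ g ∈ S, δ g ∈ I)
    (ha : ∀ d ∈ I, (S.filter fun g ↦ δ g = d).card ≤ a d) :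
    ∑ g ∈ S, F (δ g) ≤ ∑ d ∈ I, (a d : ℝ) * F d := by
  rw [← Finset.sum_fiberwise_of_maps_to hδ]
  refine Finset.sum_le_sum fun d hd ↦ ?_
  rw [Finset.sum_congr rfl (g := fun _ ↦ F d) fun g hg ↦ by rw [(Finset.mem_filter.1 hg).2],
    Finset.sum_const, nsmul_eq_mul]
  exact mul_le_mul_of_nonneg_right (by exact_mod_cast ha d hd) (hF d hd)

lemma card_mul_le_of_le {ι : Type*} (S : Finset ι) (δ : ι → ℕ) {l r : ℕ} (hl : 0 < l)
    (hS : ∀ g ∈ S, l ≤ δ g) (hr : ∑ g ∈ S, δ g ≤ r) : S.card ≤ r / l := by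
  rw [Nat.le_div_iff_mul_le hl, ← smul_eq_mul]
  exact (Finset.card_nsmul_le_sum S δ l hS).trans hr

end Cost

section Criterion

variable {K E : Type*} [Field K] [Fintype K] [Field E] [Fintype E] [Algebra K E]

open UniqueFactorizationMonoid

open scoped Classical in
lemma exists_primitive_kNormal_of_cost {h f : K[X]} (hhf : h * f = X ^ Module.finrank K E - 1)
    (D D' : Finset ℕ) (G G' : Finset K[X]) (hD : Disjoint D D') (hG : Disjoint G G')
    (hDD' : D ∪ D' = (Fintype.card E - 1).primeFactors)
    (hGG' : G ∪ G' = (normalizedFactors h).toFinset)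
    (hlt : (∏ p ∈ D, primeCost p) * (∏ g ∈ G, polyCost (Fintype.card K) g.natDegree) *
        (D'.card + G'.card + 1) * √(Fintype.card E) <
      (Fintype.card K : ℝ) ^ h.natDegree *
        (1 - (∑ p ∈ D', 1 / (p : ℝ) + ∑ g ∈ G', 1 / (Fintype.card K : ℝ) ^ g.natDegree))) :
    ∃ α : E, IsPrimitiveElem α ∧
      IsKNormal (Fintype.card K) (Module.finrank K E) f.natDegree α := by
  have hq : 1 < Fintype.card K := Fintype.one_lt_card
  have hh0 : h ≠ 0 := fun h' ↦ (monic_X_pow_sub_C (1 : K)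
    (Module.finrank_pos (R := K) (M := E)).ne').ne_zero (by rw [C_1, ← hhf, h', zero_mul])
  refine exists_primitive_kNormal_of_sieve hhf D D' G G' hD hG hDD' hGG' ?_
  have hp1 : ∀ p ∈ D, 1 < (p : ℝ) := fun p hp ↦ by
    have : p ∈ (Fintype.card E - 1).primeFactors := hDD' ▸ Finset.mem_union_left _ hp
    exact_mod_cast (Nat.prime_of_mem_primeFactors this).one_lt
  have hg1 : ∀ g ∈ G, (0 : ℝ) < (Fintype.card K : ℝ) ^ g.natDegree - 1 := fun g hg ↦ by
    have : g ∈ (normalizedFactors h).toFinset := hGG' ▸ Finset.mem_union_left _ hg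
    rw [Multiset.mem_toFinset, Polynomial.mem_normalizedFactors_iff hh0] at this
    exact pow_cast_sub_one_pos hq this.1.natDegree_pos.ne'
  have hP : (2 : ℝ) ^ D.card = (∏ p ∈ D, (1 - 1 / (p : ℝ))) * ∏ p ∈ D, primeCost p := by
    rw [← Finset.prod_mul_distrib, ← Finset.prod_const]
    refine Finset.prod_congr rfl fun p hp ↦ ?_
    have h1 := hp1 p hp
    have h2 : (p : ℝ) - 1 ≠ 0 := by linarith
    have h3 : (p : ℝ) ≠ 0 := by linarith
    rw [primeCost]; field_simp
  have hPG : (2 : ℝ) ^ G.card = (∏ g ∈ G, (1 - 1 / (Fintype.card K : ℝ) ^ g.natDegree)) *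
      ∏ g ∈ G, polyCost (Fintype.card K) g.natDegree := by
    rw [← Finset.prod_mul_distrib, ← Finset.prod_const]
    refine Finset.prod_congr rfl fun g hg ↦ ?_
    have h1 := (hg1 g hg).ne'
    have h3 : (Fintype.card K : ℝ) ^ g.natDegree ≠ 0 := by positivity
    rw [polyCost]; field_simp
  have h1 : 0 < ∏ p ∈ D, (1 - 1 / (p : ℝ)) := Finset.prod_pos fun p hp ↦ by
    have := hp1 p hp
    rw [sub_pos, div_lt_one (by linarith)]; exact this
  have h2 : 0 < ∏ g ∈ G, (1 - 1 / (Fintype.card K : ℝ) ^ g.natDegree) :=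
    Finset.prod_pos fun g hg ↦ by
      have := hg1 g hg
      rw [sub_pos, div_lt_one (by linarith)]; linarith
  rw [pow_add, hP, hPG]
  have := mul_lt_mul_of_pos_left hlt (mul_pos h1 h2)
  refine lt_of_eq_of_lt ?_ (this.trans_eq ?_) <;> ring

open scoped Classical in
lemma exists_primitive_kNormal_of_bounds {h f : K[X]}
    (hhf : h * f = X ^ Module.finrank K E - 1) {k l r s : ℕ} {σ : ℝ} (hk : 1 ≤ k) (hkl : k ≤ l)
    (a : ℕ → ℕ) (hr : ∑ g ∈ (normalizedFactors h).toFinset, g.natDegree ≤ r)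
    (ha : ∀ d, 1 ≤ d → d < l →
      ((normalizedFactors h).toFinset.filter fun g ↦ g.natDegree = d).card ≤ a d)
    (D : Finset ℕ) (hD : D ⊆ (Fintype.card E - 1).primeFactors)
    (hs : ((Fintype.card E - 1).primeFactors \ D).card ≤ s)
    (hσ : ∑ p ∈ (Fintype.card E - 1).primeFactors \ D, 1 / (p : ℝ) ≤ σ)
    (hlt : (∏ p ∈ D, primeCost p) * (∏ d ∈ Finset.Ico 1 k, polyCost (Fintype.card K) d ^ a d) *
        (s + ∑ d ∈ Finset.Ico k l, (a d : ℝ) + (r / l : ℕ) + 1) * √(Fintype.card E) <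
      (Fintype.card K : ℝ) ^ h.natDegree *
        (1 - (σ + ∑ d ∈ Finset.Ico k l, (a d : ℝ) * (1 / (Fintype.card K : ℝ) ^ d) +
          (r / l : ℕ) * (1 / (Fintype.card K : ℝ) ^ l)))) :
    ∃ α : E, IsPrimitiveElem α ∧
      IsKNormal (Fintype.card K) (Module.finrank K E) f.natDegree α := by
  have hq : 1 < Fintype.card K := Fintype.one_lt_card
  have hh0 : h ≠ 0 := fun h' ↦ (monic_X_pow_sub_C (1 : K)
    (Module.finrank_pos (R := K) (M := E)).ne').ne_zero (by rw [C_1, ← hhf, h', zero_mul])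
  set F := (normalizedFactors h).toFinset with hF
  have hF1 : ∀ g ∈ F, 1 ≤ g.natDegree := fun g hg ↦ by
    rw [hF, Multiset.mem_toFinset, Polynomial.mem_normalizedFactors_iff hh0] at hg
    exact hg.1.natDegree_pos
  have hsplit : (F.filter fun g ↦ ¬ g.natDegree < k)
      = (F.filter fun g ↦ k ≤ g.natDegree ∧ g.natDegree < l) ∪
        F.filter fun g ↦ l ≤ g.natDegree := by
    ext g; simp only [Finset.mem_filter, Finset.mem_union]
    constructor
    · rintro ⟨h1, h2⟩
      rcases lt_or_ge g.natDegree l with h3 | h3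
      · exact Or.inl ⟨h1, by omega, h3⟩
      · exact Or.inr ⟨h1, h3⟩
    · rintro (⟨h1, h2, h3⟩ | ⟨h1, h2⟩)
      · exact ⟨h1, by omega⟩
      · exact ⟨h1, by omega⟩
  have hdisj : Disjoint (F.filter fun g ↦ k ≤ g.natDegree ∧ g.natDegree < l)
      (F.filter fun g ↦ l ≤ g.natDegree) :=
    Finset.disjoint_filter.2 fun g _ h1 h2 ↦ by omega
  have hbig : (F.filter fun g ↦ l ≤ g.natDegree).card ≤ r / l := by
    refine card_mul_le_of_le _ (fun g : K[X] ↦ g.natDegree) (by omega)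
      (fun g hg ↦ (Finset.mem_filter.1 hg).2) (le_trans ?_ hr)
    exact Finset.sum_le_sum_of_subset (Finset.filter_subset _ _)
  have hmid (w : ℕ → ℝ) (hw : ∀ d, 0 ≤ w d) :
      ∑ g ∈ F.filter (fun g ↦ k ≤ g.natDegree ∧ g.natDegree < l), w g.natDegree
        ≤ ∑ d ∈ Finset.Ico k l, (a d : ℝ) * w d := by
    refine sum_comp_le_sum_mul _ (fun g : K[X] ↦ g.natDegree) _ a w (fun d _ ↦ hw d)
      (fun g hg ↦ Finset.mem_Ico.2 (Finset.mem_filter.1 hg).2) fun d hd ↦ ?_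
    have := Finset.mem_Ico.1 hd
    refine (Finset.card_le_card ?_).trans (ha d (by omega) this.2)
    exact Finset.filter_subset_filter _ (Finset.filter_subset _ _)
  have hcard : ((F.filter fun g ↦ ¬ g.natDegree < k).card : ℝ)
      ≤ ∑ d ∈ Finset.Ico k l, (a d : ℝ) + (r / l : ℕ) := by
    rw [hsplit, Finset.card_union_of_disjoint hdisj, Nat.cast_add]
    refine add_le_add ?_ (by exact_mod_cast hbig)
    simpa using hmid (fun _ ↦ 1) fun _ ↦ zero_le_one
  have hsum : ∑ g ∈ F.filter (fun g ↦ ¬ g.natDegree < k), 1 / (Fintype.card K : ℝ) ^ g.natDegree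
      ≤ ∑ d ∈ Finset.Ico k l, (a d : ℝ) * (1 / (Fintype.card K : ℝ) ^ d)
        + (r / l : ℕ) * (1 / (Fintype.card K : ℝ) ^ l) := by
    rw [hsplit, Finset.sum_union hdisj]
    refine add_le_add (hmid (fun d ↦ 1 / (Fintype.card K : ℝ) ^ d) fun d ↦ by positivity) ?_
    have h1 : ∀ g ∈ F.filter (fun g ↦ l ≤ g.natDegree),
        1 / (Fintype.card K : ℝ) ^ g.natDegree ≤ 1 / (Fintype.card K : ℝ) ^ l := fun g hg ↦ by
      refine one_div_le_one_div_of_le (by positivity) (pow_le_pow_right₀ ?_ ?_)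
      · exact_mod_cast hq.le
      · exact (Finset.mem_filter.1 hg).2
    refine (Finset.sum_le_card_nsmul _ _ _ h1).trans ?_
    rw [nsmul_eq_mul]
    exact mul_le_mul_of_nonneg_right (by exact_mod_cast hbig) (by positivity)
  have hprod : ∏ g ∈ F.filter (fun g ↦ g.natDegree < k), polyCost (Fintype.card K) g.natDegree
      ≤ ∏ d ∈ Finset.Ico 1 k, polyCost (Fintype.card K) d ^ a d := by
    refine prod_comp_le_prod_pow _ (fun g : K[X] ↦ g.natDegree) _ a _
      (fun d hd ↦ one_le_polyCost hq (by have := Finset.mem_Ico.1 hd; omega))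
      (fun g hg ↦ ?_) fun d hd ↦ ?_
    · obtain ⟨h1, h2⟩ := Finset.mem_filter.1 hg
      exact Finset.mem_Ico.2 ⟨hF1 g h1, h2⟩
    · have := Finset.mem_Ico.1 hd
      refine (Finset.card_le_card ?_).trans (ha d this.1 (by omega))
      exact Finset.filter_subset_filter _ (Finset.filter_subset _ _)
  refine exists_primitive_kNormal_of_cost hhf D ((Fintype.card E - 1).primeFactors \ D)
    (F.filter fun g ↦ g.natDegree < k) (F.filter fun g ↦ ¬ g.natDegree < k)
    Finset.disjoint_sdiff (Finset.disjoint_filter_filter_not _ _ _)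
    (Finset.union_sdiff_of_subset hD) (Finset.filter_union_filter_not_eq _ _) ?_
  have hDpos : 0 ≤ ∏ p ∈ D, primeCost p := Finset.prod_nonneg fun p hp ↦
    (primeCost_pos (Nat.prime_of_mem_primeFactors (hD hp)).one_lt).le
  have hGpos : 0 ≤ ∏ g ∈ F.filter (fun g ↦ g.natDegree < k),
      polyCost (Fintype.card K) g.natDegree := Finset.prod_nonneg fun g hg ↦
    zero_le_one.trans (one_le_polyCost hq (by have := hF1 g (Finset.mem_filter.1 hg).1; omega))
  have hs' : (((Fintype.card E - 1).primeFactors \ D).card : ℝ) ≤ s := by exact_mod_cast hs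
  refine lt_of_le_of_lt ?_ (hlt.trans_le ?_)
  · refine mul_le_mul_of_nonneg_right (mul_le_mul (mul_le_mul_of_nonneg_left hprod hDpos) ?_
      (by positivity) (mul_nonneg hDpos (hGpos.trans hprod))) (Real.sqrt_nonneg _)
    linarith
  · refine mul_le_mul_of_nonneg_left ?_ (by positivity)
    linarith

open scoped Classical in
lemma exists_primitive_kNormal_of_pow_bound {h f : K[X]}
    (hhf : h * f = X ^ Module.finrank K E - 1) {k : ℕ} (hk : 1 ≤ k)
    (a : ℕ → ℕ)
    (ha : ∀ d, 1 ≤ d → d < k →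
      ((normalizedFactors h).toFinset.filter fun g ↦ g.natDegree = d).card ≤ a d)
    (hlt : ((∏ p ∈ (Fintype.card E - 1).primeFactors, primeCost p) * √(Fintype.card E)) ^ k *
        (polyCost (Fintype.card K) k ^ h.natDegree * ∏ d ∈ Finset.Ico 1 k,
          (polyCost (Fintype.card K) d ^ k / polyCost (Fintype.card K) k ^ d) ^ a d) <
      ((Fintype.card K : ℝ) ^ h.natDegree) ^ k) :
    ∃ α : E, IsPrimitiveElem α ∧
      IsKNormal (Fintype.card K) (Module.finrank K E) f.natDegree α := by
  have hq : 1 < Fintype.card K := Fintype.one_lt_card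
  have hh0 : h ≠ 0 := fun h' ↦ (monic_X_pow_sub_C (1 : K)
    (Module.finrank_pos (R := K) (M := E)).ne').ne_zero (by rw [C_1, ← hhf, h', zero_mul])
  set F := (normalizedFactors h).toFinset with hF
  have hFm : ∀ g ∈ F, Irreducible g ∧ g.Monic ∧ g ∣ h := fun g hg ↦ by
    rwa [hF, Multiset.mem_toFinset, Polynomial.mem_normalizedFactors_iff hh0] at hg
  have hF1 : ∀ g ∈ F, 1 ≤ g.natDegree := fun g hg ↦ (hFm g hg).1.natDegree_pos
  have hsumF : ∑ g ∈ F, g.natDegree ≤ h.natDegree :=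
    sum_natDegree_le_of_dvd F (fun g hg ↦ ⟨(hFm g hg).2.1, (hFm g hg).1⟩) hh0
      fun g hg ↦ (hFm g hg).2.2
  set c := polyCost (Fintype.card K) with hc
  have hck : 1 ≤ c k := one_le_polyCost hq (by omega)
  have hratio : ∀ d ∈ Finset.Ico 1 k, 1 ≤ c d ^ k / c k ^ d := fun d hd ↦ by
    obtain ⟨h1, h2⟩ := Finset.mem_Ico.1 hd
    rw [one_le_div (by positivity)]
    exact (pow_le_pow_right₀ hck h2.le).trans
      (pow_le_pow_left₀ (by positivity) (polyCost_anti hq (by omega) h2.le) _)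
  have hprod : (∏ g ∈ F, c g.natDegree) ^ k
      ≤ c k ^ h.natDegree * ∏ d ∈ Finset.Ico 1 k, (c d ^ k / c k ^ d) ^ a d := by
    rw [← Finset.prod_filter_mul_prod_filter_not F (fun g : K[X] ↦ g.natDegree < k), mul_pow,
      ← Finset.prod_pow, ← Finset.prod_pow]
    have h1 : ∏ g ∈ F.filter (fun g ↦ g.natDegree < k), c g.natDegree ^ k
        = (∏ g ∈ F.filter (fun g ↦ g.natDegree < k), c g.natDegree ^ k / c k ^ g.natDegree) *
          ∏ g ∈ F.filter (fun g ↦ g.natDegree < k), c k ^ g.natDegree := by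
      rw [← Finset.prod_mul_distrib]
      refine Finset.prod_congr rfl fun g _ ↦ ?_
      have : c k ^ g.natDegree ≠ 0 := by positivity
      field_simp
    have h2 : ∏ g ∈ F.filter (fun g ↦ ¬ g.natDegree < k), c g.natDegree ^ k
        ≤ ∏ g ∈ F.filter (fun g ↦ ¬ g.natDegree < k), c k ^ g.natDegree := by
      refine Finset.prod_le_prod (fun g hg ↦ ?_) fun g hg ↦ ?_
      · have := one_le_polyCost hq (show g.natDegree ≠ 0 by
          have := hF1 g (Finset.mem_filter.1 hg).1; omega)
        positivity
      · have h3 := (Finset.mem_filter.1 hg).2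
        have h4 := one_le_polyCost hq (show g.natDegree ≠ 0 by
          have := hF1 g (Finset.mem_filter.1 hg).1; omega)
        exact (pow_le_pow_left₀ (by positivity) (polyCost_anti hq (by omega) (by omega)) _).trans
          (pow_le_pow_right₀ hck (by omega))
    have h3 : (∏ g ∈ F.filter (fun g ↦ g.natDegree < k), c k ^ g.natDegree) *
        ∏ g ∈ F.filter (fun g ↦ ¬ g.natDegree < k), c k ^ g.natDegree ≤ c k ^ h.natDegree := by
      rw [Finset.prod_filter_mul_prod_filter_not, Finset.prod_pow_eq_pow_sum]
      exact pow_le_pow_right₀ hck hsumF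
    have h4 : ∏ g ∈ F.filter (fun g ↦ g.natDegree < k), c g.natDegree ^ k / c k ^ g.natDegree
        ≤ ∏ d ∈ Finset.Ico 1 k, (c d ^ k / c k ^ d) ^ a d := by
      refine prod_comp_le_prod_pow _ (fun g : K[X] ↦ g.natDegree) _ a
        (fun d ↦ c d ^ k / c k ^ d) hratio (fun g hg ↦ ?_) fun d hd ↦ ?_
      · obtain ⟨h1, h2⟩ := Finset.mem_filter.1 hg
        exact Finset.mem_Ico.2 ⟨hF1 g h1, h2⟩
      · have := Finset.mem_Ico.1 hd
        refine (Finset.card_le_card ?_).trans (ha d this.1 (by omega))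
        exact Finset.filter_subset_filter _ (Finset.filter_subset _ _)
    have h5 : 0 ≤ ∏ d ∈ Finset.Ico 1 k, (c d ^ k / c k ^ d) ^ a d :=
      Finset.prod_nonneg fun d hd ↦ pow_nonneg (zero_le_one.trans (hratio d hd)) _
    have h6 : 0 ≤ ∏ g ∈ F.filter (fun g ↦ g.natDegree < k), c k ^ g.natDegree :=
      Finset.prod_nonneg fun g _ ↦ by positivity
    rw [h1, mul_assoc, mul_comm]
    refine mul_le_mul ((mul_le_mul_of_nonneg_left h2 h6).trans h3) h4 ?_ (by positivity)
    exact Finset.prod_nonneg fun g hg ↦ div_nonneg (pow_nonneg (zero_le_one.trans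
      (one_le_polyCost hq (by have := hF1 g (Finset.mem_filter.1 hg).1; omega))) _)
      (by positivity)
  have hDpos : 0 ≤ ∏ p ∈ (Fintype.card E - 1).primeFactors, primeCost p :=
    Finset.prod_nonneg fun p hp ↦ (primeCost_pos (Nat.prime_of_mem_primeFactors hp).one_lt).le
  refine exists_primitive_kNormal_of_cost hhf (Fintype.card E - 1).primeFactors ∅ F ∅
    (Finset.disjoint_empty_right _) (Finset.disjoint_empty_right _) (Finset.union_empty _)
    (Finset.union_empty _) ?_
  simp only [Finset.card_empty, Finset.sum_empty, Nat.cast_zero, add_zero, zero_add, sub_zero,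
    mul_one]
  refine lt_of_pow_lt_pow_left₀ k (by positivity) (lt_of_le_of_lt ?_ hlt)
  rw [mul_right_comm, mul_pow]
  exact mul_le_mul_of_nonneg_left hprod (by positivity)

end Criterion

lemma primeCost_pow_four_le {p : ℕ} (hp : 20 ≤ p) : primeCost p ^ 4 ≤ p := by
  have hp' : (20 : ℝ) ≤ p := by exact_mod_cast hp
  have h1 : primeCost p ≤ 40 / 19 := by
    rw [primeCost, div_le_div_iff₀ (by linarith) (by norm_num)]
    linarith
  calc primeCost p ^ 4 ≤ (40 / 19) ^ 4 :=
        pow_le_pow_left₀ (primeCost_pos (by omega)).le h1 4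
    _ ≤ 20 := by norm_num
    _ ≤ p := hp'

lemma prod_primeCost_pow_four_le {m : ℕ} (hm : m ≠ 0) :
    (∏ p ∈ m.primeFactors, primeCost p) ^ 4 ≤ 27 ^ 4 * m := by
  have hpr : ∀ p ∈ m.primeFactors, p.Prime := fun p hp ↦ Nat.prime_of_mem_primeFactors hp
  have h0 : ∀ p : ℕ, p.Prime → 0 ≤ primeCost p ^ 4 / p := fun p hp ↦ by
    have := (primeCost_pos hp.one_lt).le
    positivity
  set T : Finset ℕ := {2, 3, 5, 7, 11, 13, 17, 19} with hT
  have hTp : ∀ p ∈ T, p.Prime ∧ 1 ≤ primeCost p ^ 4 / p := by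
    simp only [hT, Finset.mem_insert, Finset.mem_singleton, forall_eq_or_imp, forall_eq, primeCost]
    norm_num
  have hTm : ∀ p, p.Prime → p ∉ T → 20 ≤ p := fun p hp hpT ↦ by
    by_contra! h
    interval_cases p <;> first | (revert hp; norm_num; done) | (exact hpT (by simp [hT]))
  have hle : ∏ p ∈ m.primeFactors, primeCost p ^ 4 / p ≤ 27 ^ 4 := by
    rw [← Finset.prod_inter_mul_prod_sdiff m.primeFactors T]
    have h1 : ∏ p ∈ m.primeFactors \ T, primeCost p ^ 4 / (p : ℝ) ≤ 1 := by
      refine Finset.prod_le_one (fun p hp ↦ h0 p (hpr p (Finset.mem_sdiff.1 hp).1)) fun p hp ↦ ?_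
      obtain ⟨h1, h2⟩ := Finset.mem_sdiff.1 hp
      have := hTm p (hpr p h1) h2
      have h3 : (0 : ℝ) < p := by exact_mod_cast (by omega : 0 < p)
      rw [div_le_one h3]
      exact primeCost_pow_four_le this
    have h2 : ∏ p ∈ m.primeFactors ∩ T, primeCost p ^ 4 / (p : ℝ)
        ≤ ∏ p ∈ T, primeCost p ^ 4 / (p : ℝ) := by
      rw [Finset.inter_comm, ← Finset.prod_inter_mul_prod_sdiff T m.primeFactors]
      refine le_mul_of_one_le_right ?_ ?_
      · exact Finset.prod_nonneg fun p hp ↦ h0 p (hTp p (Finset.mem_inter.1 hp).1).1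
      · exact Finset.one_le_prod fun p hp ↦ (hTp p (Finset.mem_sdiff.1 hp).1).2
    have h3 : ∏ p ∈ T, primeCost p ^ 4 / (p : ℝ) ≤ 27 ^ 4 := by
      simp only [hT, primeCost]
      norm_num
    calc _ ≤ (∏ p ∈ T, primeCost p ^ 4 / (p : ℝ)) * 1 := by
          refine mul_le_mul h2 h1 (Finset.prod_nonneg fun p hp ↦
            h0 p (hpr p (Finset.mem_sdiff.1 hp).1)) (Finset.prod_nonneg fun p hp ↦ h0 p (hTp p hp).1)
      _ ≤ 27 ^ 4 := by rw [mul_one]; exact h3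
  have hprod : (∏ p ∈ m.primeFactors, (p : ℝ)) ≤ m := by
    rw [← Nat.cast_prod]
    exact_mod_cast Nat.le_of_dvd (Nat.pos_of_ne_zero hm) (Nat.prod_primeFactors_dvd m)
  calc (∏ p ∈ m.primeFactors, primeCost p) ^ 4
      = (∏ p ∈ m.primeFactors, primeCost p ^ 4 / (p : ℝ)) * ∏ p ∈ m.primeFactors, (p : ℝ) := by
        rw [← Finset.prod_pow, ← Finset.prod_mul_distrib]
        refine Finset.prod_congr rfl fun p hp ↦ ?_
        have : (p : ℝ) ≠ 0 := by exact_mod_cast (hpr p hp).ne_zero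
        field_simp
    _ ≤ 27 ^ 4 * m := mul_le_mul hle hprod (by positivity) (by positivity)

/-- The numerical inequality to which the sieve over `𝔽_{q^n}` reduces when the primes in `D` and
the irreducible polynomials of degree less than `k` are not sieved. -/
def SieveBound (q n r s B k l : ℕ) (a : ℕ → ℕ) (D : Finset ℕ) : Prop :=
  ((∏ p ∈ D, 2 * p) * (∏ d ∈ Finset.Ico 1 k, (2 * q ^ d) ^ a d) *
      (s + ∑ d ∈ Finset.Ico k l, a d + r / l + 1) * (B * q ^ l)) ^ 2 <
    q ^ (n - 4) * ((∏ p ∈ D, (p - 1)) * (∏ d ∈ Finset.Ico 1 k, (q ^ d - 1) ^ a d) *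
      (B * q ^ l - (s * q ^ l + ∑ d ∈ Finset.Ico k l, B * a d * q ^ (l - d) + B * (r / l)))) ^ 2

instance (q n r s B k l : ℕ) (a : ℕ → ℕ) (D : Finset ℕ) :
    Decidable (SieveBound q n r s B k l a D) := by
  unfold SieveBound; infer_instance

lemma SieveBound.real {q n r s B k l : ℕ} {a : ℕ → ℕ} {D : Finset ℕ}
    (h : SieveBound q n r s B k l a D) (hq : 1 < q) (hn : 4 ≤ n) (hB : 0 < B)
    (hD : ∀ p ∈ D, 1 < p) :
    (∏ p ∈ D, primeCost p) * (∏ d ∈ Finset.Ico 1 k, polyCost q d ^ a d) *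
        (s + ∑ d ∈ Finset.Ico k l, (a d : ℝ) + (r / l : ℕ) + 1) * √((q : ℝ) ^ n) <
      (q : ℝ) ^ (n - 2) * (1 - ((s : ℝ) / B + ∑ d ∈ Finset.Ico k l, (a d : ℝ) * (1 / (q : ℝ) ^ d) +
          (r / l : ℕ) * (1 / (q : ℝ) ^ l))) := by
  unfold SieveBound at h
  set t := r / l
  have hq0 : (0 : ℝ) < q := by exact_mod_cast (by omega : 0 < q)
  have hB0 : (0 : ℝ) < B := by exact_mod_cast hB
  set T := s * q ^ l + ∑ d ∈ Finset.Ico k l, B * a d * q ^ (l - d) + B * t with hT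
  have hTB : T < B * q ^ l := by
    by_contra! h'
    rw [Nat.sub_eq_zero_of_le h'] at h
    simp at h
  set P := ∏ p ∈ D, primeCost p with hP
  set G := ∏ d ∈ Finset.Ico 1 k, polyCost q d ^ a d with hG
  have hPe : P * ((∏ p ∈ D, (p - 1) : ℕ) : ℝ) = ((∏ p ∈ D, 2 * p : ℕ) : ℝ) := by
    rw [hP, Nat.cast_prod, Nat.cast_prod, ← Finset.prod_mul_distrib]
    refine Finset.prod_congr rfl fun p hp ↦ ?_
    have h1 := hD p hp
    have h2 : (1 : ℝ) < p := by exact_mod_cast h1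
    rw [primeCost, Nat.cast_sub h1.le, Nat.cast_one, div_mul_cancel₀ _ (by linarith)]
    push_cast; ring
  have hGe : G * ((∏ d ∈ Finset.Ico 1 k, (q ^ d - 1) ^ a d : ℕ) : ℝ)
      = ((∏ d ∈ Finset.Ico 1 k, (2 * q ^ d) ^ a d : ℕ) : ℝ) := by
    rw [hG, Nat.cast_prod, Nat.cast_prod, ← Finset.prod_mul_distrib]
    refine Finset.prod_congr rfl fun d hd ↦ ?_
    have h1 := pow_cast_sub_one_pos hq (show d ≠ 0 by have := Finset.mem_Ico.1 hd; omega)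
    rw [polyCost, Nat.cast_pow, ← mul_pow, Nat.cast_sub (Nat.one_le_pow _ _ (by omega))]
    push_cast
    rw [div_mul_cancel₀ _ h1.ne']
  have hτ : (B * (q : ℝ) ^ l) * (1 - ((s : ℝ) / B +
      ∑ d ∈ Finset.Ico k l, (a d : ℝ) * (1 / (q : ℝ) ^ d) + t * (1 / (q : ℝ) ^ l)))
      = ((B * q ^ l - T : ℕ) : ℝ) := by
    rw [Nat.cast_sub hTB.le, hT]
    push_cast
    rw [mul_sub, mul_one, mul_add, mul_add, Finset.mul_sum]
    congr 2
    · congr 1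
      · field_simp
      · refine Finset.sum_congr rfl fun d hd ↦ ?_
        have : (q : ℝ) ^ l = q ^ (l - d) * q ^ d := by
          rw [← pow_add, Nat.sub_add_cancel (Finset.mem_Ico.1 hd).2.le]
        rw [this]; field_simp
    · field_simp
  set τ := 1 - ((s : ℝ) / B + ∑ d ∈ Finset.Ico k l, (a d : ℝ) * (1 / (q : ℝ) ^ d) +
    t * (1 / (q : ℝ) ^ l)) with hτ'
  have hb : (0 : ℝ) < B * (q : ℝ) ^ l := by positivity
  have hτ0 : 0 < τ := by
    have : (0 : ℝ) < ((B * q ^ l - T : ℕ) : ℝ) := by exact_mod_cast Nat.sub_pos_of_lt hTB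
    rw [← hτ] at this
    exact pos_of_mul_pos_right this hb.le
  have hR := (Nat.cast_lt (α := ℝ)).2 h
  simp only [Nat.cast_pow, Nat.cast_mul] at hR
  rw [← hPe, ← hGe, ← hτ] at hR
  set x := ((∏ p ∈ D, (p - 1) : ℕ) : ℝ)
  set y := ((∏ d ∈ Finset.Ico 1 k, (q ^ d - 1) ^ a d : ℕ) : ℝ)
  push_cast at hR
  refine lt_of_pow_lt_pow_left₀ 2 (by positivity) ?_
  rw [mul_pow _ (√_), Real.sq_sqrt (by positivity)]
  set S := (s : ℝ) + ∑ d ∈ Finset.Ico k l, (a d : ℝ) + t + 1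
  have hxy : 0 < (x * y * (B * (q : ℝ) ^ l)) ^ 2 := by
    refine lt_of_le_of_ne (by positivity) fun h0 ↦ ?_
    have : (q : ℝ) ^ (n - 4) * (x * y * (B * (q : ℝ) ^ l * τ)) ^ 2
      = q ^ (n - 4) * τ ^ 2 * (x * y * (B * (q : ℝ) ^ l)) ^ 2 := by ring
    rw [this, ← h0, mul_zero] at hR
    exact absurd hR (not_lt.2 (by positivity))
  refine lt_of_mul_lt_mul_left ?_ hxy.le
  have hpow : (q : ℝ) ^ (n - 4) * q ^ n = (q ^ (n - 2)) ^ 2 := by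
    rw [← pow_add, ← pow_mul]; congr 1; omega
  calc _ = (P * x * (G * y) * S * (B * (q : ℝ) ^ l)) ^ 2 * q ^ n := by ring
    _ < q ^ (n - 4) * (x * y * (B * (q : ℝ) ^ l * τ)) ^ 2 * q ^ n :=
      mul_lt_mul_of_pos_right hR (by positivity)
    _ = _ := by rw [mul_right_comm, hpow]; ring

lemma card_primeFactors_sdiff_le_log {m B : ℕ} (hm : m ≠ 0) (hB : 1 < B) {D : Finset ℕ}
    (hD : D ⊆ m.primeFactors) (hDB : ∀ p ∈ m.primeFactors \ D, B ≤ p) :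
    (m.primeFactors \ D).card ≤ Nat.log B (m / ∏ p ∈ D, p) := by
  have hpos : 0 < ∏ p ∈ D, p :=
    Finset.prod_pos fun p hp ↦ (Nat.prime_of_mem_primeFactors (hD hp)).pos
  have h1 : B ^ (m.primeFactors \ D).card ≤ m / ∏ p ∈ D, p := by
    refine (Finset.pow_card_le_prod _ _ B hDB).trans ?_
    rw [Nat.le_div_iff_mul_le hpos, Finset.prod_sdiff hD]
    exact Nat.le_of_dvd (Nat.pos_of_ne_zero hm) (Nat.prod_primeFactors_dvd m)
  exact Nat.le_log_of_pow_le hB h1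

lemma sum_one_div_le_div {S : Finset ℕ} {B s : ℕ} (hB : 0 < B) (hS : ∀ p ∈ S, B ≤ p)
    (hs : S.card ≤ s) : ∑ p ∈ S, 1 / (p : ℝ) ≤ (s : ℝ) / B := by
  have hB' : (0 : ℝ) < B := by exact_mod_cast hB
  refine (Finset.sum_le_card_nsmul S _ (1 / (B : ℝ)) fun p hp ↦
    one_div_le_one_div_of_le hB' (by exact_mod_cast hS p hp)).trans ?_
  rw [nsmul_eq_mul, mul_one_div]
  exact div_le_div_of_nonneg_right (by exact_mod_cast hs) hB'.le

/-- The primes below `84`. -/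
def smallPrimes : Finset ℕ :=
  {2, 3, 5, 7, 11, 13, 17, 19, 23, 29, 31, 37, 41, 43, 47, 53, 59, 61, 67, 71, 73, 79, 83}

lemma prime_of_mem_smallPrimes {p : ℕ} (hp : p ∈ smallPrimes) : p.Prime := by
  revert p
  simp only [smallPrimes, Finset.mem_insert, Finset.mem_singleton, forall_eq_or_imp, forall_eq]
  norm_num

lemma mem_smallPrimes {p : ℕ} (hp : p.Prime) (h : p < 84) : p ∈ smallPrimes := by
  interval_cases p <;> first | (revert hp; norm_num; done) | decide

section Criterion

variable {K E : Type*} [Field K] [Field E] [Fintype E] [Algebra K E]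

open UniqueFactorizationMonoid

lemma ne_zero_of_mul_eq_X_pow_finrank_sub_one {h f : K[X]}
    (hhf : h * f = X ^ Module.finrank K E - 1) : h ≠ 0 := fun h' ↦
  (monic_X_pow_sub_C (1 : K) (Module.finrank_pos (R := K) (M := E)).ne').ne_zero
    (by rw [C_1, ← hhf, h', zero_mul])

open scoped Classical in
lemma sum_natDegree_normalizedFactors_le {h P : K[X]} (hh : h ≠ 0) (hP : P ≠ 0)
    (hhP : ∀ g, Irreducible g → g ∣ h → g ∣ P) :
    ∑ g ∈ (normalizedFactors h).toFinset, g.natDegree ≤ P.natDegree := by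
  have hF : ∀ g ∈ (normalizedFactors h).toFinset, Irreducible g ∧ g.Monic ∧ g ∣ h := fun g hg ↦ by
    rwa [Multiset.mem_toFinset, Polynomial.mem_normalizedFactors_iff hh] at hg
  exact sum_natDegree_le_of_dvd _ (fun g hg ↦ ⟨(hF g hg).2.1, (hF g hg).1⟩) hP
    fun g hg ↦ hhP g (hF g hg).1 (hF g hg).2.2

variable [Fintype K]

open scoped Classical in
lemma card_filter_normalizedFactors_mul_le {h : K[X]} (hh : h ≠ 0) {n d : ℕ} (hn : n ≠ 0)
    (hhn : h ∣ X ^ n - 1) (hd : d ≠ 0) :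
    ((normalizedFactors h).toFinset.filter fun g ↦ g.natDegree = d).card * d ≤
      n.gcd (Fintype.card K ^ d - 1) := by
  have hF : ∀ g ∈ (normalizedFactors h).toFinset, Irreducible g ∧ g.Monic ∧ g ∣ h := fun g hg ↦ by
    rwa [Multiset.mem_toFinset, Polynomial.mem_normalizedFactors_iff hh] at hg
  exact card_filter_natDegree_eq_mul_le _ (fun g hg ↦ ⟨(hF g hg).2.1, (hF g hg).1⟩) hn
    (fun g hg ↦ (hF g hg).2.2.trans hhn) hd

open scoped Classical in
lemma exists_primitive_kNormal_of_sieveBound {h f : K[X]}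
    (hhf : h * f = X ^ Module.finrank K E - 1) (hdeg : h.natDegree = Module.finrank K E - 2)
    (hn : 4 ≤ Module.finrank K E) {r s B k l : ℕ} (hB : 0 < B) (hk : 1 ≤ k) (hkl : k ≤ l)
    (hr : ∑ g ∈ (normalizedFactors h).toFinset, g.natDegree ≤ r)
    (D : Finset ℕ) (hD : D ⊆ (Fintype.card E - 1).primeFactors)
    (hs : ((Fintype.card E - 1).primeFactors \ D).card ≤ s)
    (hσ : ∑ p ∈ (Fintype.card E - 1).primeFactors \ D, 1 / (p : ℝ) ≤ (s : ℝ) / B)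
    (hlt : SieveBound (Fintype.card K) (Module.finrank K E) r s B k l
      (fun d ↦ (Module.finrank K E).gcd (Fintype.card K ^ d - 1) / d) D) :
    ∃ α : E, IsPrimitiveElem α ∧
      IsKNormal (Fintype.card K) (Module.finrank K E) f.natDegree α := by
  refine exists_primitive_kNormal_of_bounds hhf hk hkl
    (fun d ↦ (Module.finrank K E).gcd (Fintype.card K ^ d - 1) / d) hr (fun d hd _ ↦ ?_) D hD hs hσ ?_
  · rw [Nat.le_div_iff_mul_le hd]
    exact card_filter_normalizedFactors_mul_le (ne_zero_of_mul_eq_X_pow_finrank_sub_one hhf)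
      (by omega) (Dvd.intro _ hhf) (by omega)
  · rw [hdeg, Module.card_eq_pow_finrank (K := K) (V := E), Nat.cast_pow]
    exact hlt.real Fintype.one_lt_card hn hB fun p hp ↦
      (Nat.prime_of_mem_primeFactors (hD hp)).one_lt

/-- `SieveBound` with the primes below `84` and the degrees below `k` not sieved. -/
def SmallSieveBound (q n k l : ℕ) : Prop :=
  SieveBound q n (n - 2)
    (Nat.log 84 ((q ^ n - 1) / ∏ p ∈ smallPrimes.filter (· ∣ q ^ n - 1), p)) 84 k l
    (fun d ↦ n.gcd (q ^ d - 1) / d) (smallPrimes.filter (· ∣ q ^ n - 1))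

instance (q n k l : ℕ) : Decidable (SmallSieveBound q n k l) := by
  unfold SmallSieveBound; infer_instance

lemma exists_primitive_kNormal_of_smallSieveBound {h f : K[X]}
    (hhf : h * f = X ^ Module.finrank K E - 1) (hdeg : h.natDegree = Module.finrank K E - 2)
    (hn : 4 ≤ Module.finrank K E) {k l : ℕ} (hk : 1 ≤ k) (hkl : k ≤ l)
    (hlt : SmallSieveBound (Fintype.card K) (Module.finrank K E) k l) :
    ∃ α : E, IsPrimitiveElem α ∧
      IsKNormal (Fintype.card K) (Module.finrank K E) f.natDegree α := by
  classical
  have hE := Module.card_eq_pow_finrank (K := K) (V := E)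
  have hm : Fintype.card E - 1 ≠ 0 := by
    have := Fintype.one_lt_card (α := E); omega
  rw [SmallSieveBound, ← hE] at hlt
  set D := smallPrimes.filter (· ∣ Fintype.card E - 1) with hD
  have hDsub : D ⊆ (Fintype.card E - 1).primeFactors := fun p hp ↦ by
    obtain ⟨h1, h2⟩ := Finset.mem_filter.1 hp
    exact Nat.mem_primeFactors.2 ⟨prime_of_mem_smallPrimes h1, h2, hm⟩
  have hDB : ∀ p ∈ (Fintype.card E - 1).primeFactors \ D, 84 ≤ p := fun p hp ↦ by
    obtain ⟨h1, h2⟩ := Finset.mem_sdiff.1 hp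
    obtain ⟨h3, h4, -⟩ := Nat.mem_primeFactors.1 h1
    by_contra! h5
    exact h2 (Finset.mem_filter.2 ⟨mem_smallPrimes h3 h5, h4⟩)
  have hs := card_primeFactors_sdiff_le_log hm (by norm_num) hDsub hDB
  have hh := ne_zero_of_mul_eq_X_pow_finrank_sub_one hhf
  refine exists_primitive_kNormal_of_sieveBound hhf hdeg hn (by norm_num) hk hkl ?_ D hDsub hs
    (sum_one_div_le_div (by norm_num) hDB hs) hlt
  rw [← hdeg]
  exact sum_natDegree_normalizedFactors_le hh hh fun g _ hg ↦ hg

end Criterion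

lemma smallSieveBound_of_lt {q n : ℕ} (hq : 1 < q) (hq46 : q < 47) (hn : 19 ≤ n) (hqn : q ≤ n)
    (hn' : n < if q = 2 then 152 else if q < 8 then 110 else 62) (hgcd : (q ^ 3 - q).gcd n ≠ 1)
    (h20 : ¬ (q = 2 ∧ n = 20)) (h24 : ¬ (q = 2 ∧ n = 24)) :
    SmallSieveBound q n 2 4 ∨ SmallSieveBound q n 3 6 := by
  have key : ∀ q ∈ Finset.Ico 2 47,
      ∀ n ∈ Finset.Ico (max 19 q) (if q = 2 then 152 else if q < 8 then 110 else 62),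
      (q ^ 3 - q).gcd n ≠ 1 → ¬ (q = 2 ∧ n = 20) → ¬ (q = 2 ∧ n = 24) →
      SmallSieveBound q n 2 4 ∨ SmallSieveBound q n 3 6 := by decide +kernel
  exact key q (Finset.mem_Ico.2 ⟨hq, hq46⟩) n (Finset.mem_Ico.2 ⟨max_le hn hqn, hn'⟩) hgcd h20 h24

section BinaryField

variable {K E : Type*} [Field K] [Fintype K] [Field E] [Fintype E] [Algebra K E]

lemma exists_primitive_kNormal_of_card_eq_two {h f : K[X]}
    (hhf : h * f = X ^ Module.finrank K E - 1) (hdeg : h.natDegree = Module.finrank K E - 2)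
    (hK : Fintype.card K = 2) {m e : ℕ} (hm : 2 ≤ m) (he : 1 ≤ e)
    (hn : Module.finrank K E = m * 2 ^ e) {B k l : ℕ}
    (hB : 0 < B) (hk : 1 ≤ k) (hkl : k ≤ l) (D D' : Finset ℕ)
    (hD : ∀ p ∈ D, p.Prime ∧ p ∣ 2 ^ (m * 2 ^ e) - 1)
    (hDD' : ∀ p, p.Prime → p ∣ 2 ^ (m * 2 ^ e) - 1 → p ∈ D ∨ p ∈ D')
    (hσ : ∑ p ∈ D', 1 / (p : ℝ) ≤ (D'.card : ℝ) / B)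
    (hlt : SieveBound 2 (m * 2 ^ e) m D'.card B k l (fun d ↦ (m * 2 ^ e).gcd (2 ^ d - 1) / d) D) :
    ∃ α : E, IsPrimitiveElem α ∧
      IsKNormal (Fintype.card K) (Module.finrank K E) f.natDegree α := by
  classical
  have hE : Fintype.card E = 2 ^ (m * 2 ^ e) := by
    rw [Module.card_eq_pow_finrank (K := K) (V := E), hK, hn]
  have hn4 : 4 ≤ Module.finrank K E := by
    rw [hn]
    exact Nat.mul_le_mul hm (Nat.pow_le_pow_right two_pos he)
  have : Fact (Nat.Prime 2) := ⟨Nat.prime_two⟩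
  have : CharP K 2 := charP_of_card_eq_prime hK
  have hh := ne_zero_of_mul_eq_X_pow_finrank_sub_one hhf
  have hmonic : (X ^ m - 1 : K[X]).Monic := monic_X_pow_sub_C 1 (by omega)
  have hsub : (Fintype.card E - 1).primeFactors \ D ⊆ D' := fun p hp ↦ by
    obtain ⟨h1, h2⟩ := Finset.mem_sdiff.1 hp
    obtain ⟨h3, h4, -⟩ := Nat.mem_primeFactors.1 h1
    exact (hDD' p h3 (hE ▸ h4)).resolve_left h2
  refine exists_primitive_kNormal_of_sieveBound hhf hdeg hn4 hB hk hkl (r := m)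
    (s := D'.card) ?_ D (fun p hp ↦ ?_) (Finset.card_le_card hsub) (le_trans ?_ hσ)
    (by rw [hK, hn]; exact hlt)
  · have h1 : (X ^ m - 1 : K[X]).natDegree = m := natDegree_X_pow_sub_C (r := 1)
    rw [← h1]
    refine h1.symm ▸ sum_natDegree_normalizedFactors_le hh hmonic.ne_zero fun g hg hgh ↦ ?_
    have h2 : g ∣ (X ^ m - 1) ^ 2 ^ e := by
      rw [sub_pow_char_pow, one_pow, ← pow_mul, ← hn, ← hhf]
      exact hgh.mul_right f
    exact hg.prime.dvd_of_dvd_pow h2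
  · rw [hE]
    exact Nat.mem_primeFactors.2 ⟨(hD p hp).1, (hD p hp).2,
      (Nat.sub_pos_of_lt (Nat.one_lt_pow (by omega) one_lt_two)).ne'⟩
  · exact Finset.sum_le_sum_of_subset_of_nonneg hsub fun p _ _ ↦ by positivity

lemma exists_primitive_kNormal_of_card_eq_two_of_finrank_eq_twenty {h f : K[X]}
    (hhf : h * f = X ^ Module.finrank K E - 1) (hdeg : h.natDegree = Module.finrank K E - 2)
    (hK : Fintype.card K = 2) (hn : Module.finrank K E = 20) :
    ∃ α : E, IsPrimitiveElem α ∧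
      IsKNormal (Fintype.card K) (Module.finrank K E) f.natDegree α := by
  refine exists_primitive_kNormal_of_card_eq_two hhf hdeg hK (m := 5) (e := 2) (by norm_num) (by norm_num) hn (B := 11)
    (k := 2) (l := 4) (by norm_num) (by norm_num) (by norm_num) {3} {5, 11, 31, 41} (by norm_num)
    (fun p hp hpd ↦ ?_) (by norm_num) (by decide +kernel)
  rw [show 2 ^ (5 * 2 ^ 2) - 1 = 3 * 5 * 5 * 11 * 31 * 41 by norm_num] at hpd
  simp only [hp.dvd_mul, Nat.prime_dvd_prime_iff_eq hp, Nat.prime_three, Nat.prime_five,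
    show Nat.Prime 11 by norm_num, show Nat.Prime 31 by norm_num,
    show Nat.Prime 41 by norm_num] at hpd
  simp only [Finset.mem_insert, Finset.mem_singleton]
  tauto

lemma exists_primitive_kNormal_of_card_eq_two_of_finrank_eq_twentyFour {h f : K[X]}
    (hhf : h * f = X ^ Module.finrank K E - 1) (hdeg : h.natDegree = Module.finrank K E - 2)
    (hK : Fintype.card K = 2) (hn : Module.finrank K E = 24) :
    ∃ α : E, IsPrimitiveElem α ∧
      IsKNormal (Fintype.card K) (Module.finrank K E) f.natDegree α := by
  refine exists_primitive_kNormal_of_card_eq_two hhf hdeg hK (m := 3) (e := 3) (by norm_num) (by norm_num) hn (B := 14)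
    (k := 2) (l := 3) (by norm_num) (by norm_num) (by norm_num) {3, 5} {7, 13, 17, 241}
    (by norm_num) (fun p hp hpd ↦ ?_) (by norm_num) (by decide +kernel)
  rw [show 2 ^ (3 * 2 ^ 3) - 1 = 3 * 3 * 5 * 7 * 13 * 17 * 241 by norm_num] at hpd
  simp only [hp.dvd_mul, Nat.prime_dvd_prime_iff_eq hp, Nat.prime_three, Nat.prime_five,
    show Nat.Prime 7 by norm_num, show Nat.Prime 13 by norm_num,
    show Nat.Prime 17 by norm_num, show Nat.Prime 241 by norm_num] at hpd
  simp only [Finset.mem_insert, Finset.mem_singleton]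
  tauto

end BinaryField

/-- The numerical inequality to which the sieve over `𝔽_{q^n}` reduces when nothing is sieved and
the cost of the irreducible polynomials of degree at least `k` is estimated by
`polyCost q k ^ (1 / k)` per unit of degree. -/
def CoreBound (q k n : ℕ) : Prop :=
  27 ^ (4 * k) * (polyCost q k ^ (n - 2) * ∏ d ∈ Finset.Ico 1 k,
    (polyCost q d ^ k / polyCost q k ^ d) ^ ((q ^ d - 1) / d)) ^ 4 ≤ (q : ℝ) ^ (k * (n - 8))

lemma CoreBound.mono {q k m n : ℕ} (hq : 1 < q) (hk : k ≠ 0) (hc : polyCost q k ^ 4 ≤ (q : ℝ) ^ k)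
    (hm : 8 ≤ m) (h : CoreBound q k m) (hmn : m ≤ n) : CoreBound q k n := by
  induction n, hmn using Nat.le_induction with
  | base => exact h
  | succ n hmn ih =>
    have h0 : 0 < polyCost q k := zero_lt_one.trans_le (one_le_polyCost hq hk)
    unfold CoreBound at ih ⊢
    rw [show n + 1 - 2 = (n - 2) + 1 by omega, show n + 1 - 8 = (n - 8) + 1 by omega, pow_succ,
      mul_add k, mul_one, pow_add (q : ℝ)]
    refine le_trans (le_of_eq ?_) (mul_le_mul ih hc (by positivity) (by positivity))
    ring

/-- The inequality `CoreBound` with denominators cleared. -/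
def NatCoreBound (q k n : ℕ) : Prop :=
  27 ^ (4 * k) * ((2 * q ^ k) ^ (n - 2) * ∏ d ∈ Finset.Ico 1 k,
      ((2 * q ^ d) ^ k * (q ^ k - 1) ^ d) ^ ((q ^ d - 1) / d)) ^ 4 ≤
    q ^ (k * (n - 8)) * ((q ^ k - 1) ^ (n - 2) * ∏ d ∈ Finset.Ico 1 k,
      ((q ^ d - 1) ^ k * (2 * q ^ k) ^ d) ^ ((q ^ d - 1) / d)) ^ 4

instance (q k n : ℕ) : Decidable (NatCoreBound q k n) := by
  unfold NatCoreBound; infer_instance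

lemma polyCost_mul_cast {q d : ℕ} (hq : 1 < q) (hd : d ≠ 0) :
    polyCost q d * ((q ^ d - 1 : ℕ) : ℝ) = ((2 * q ^ d : ℕ) : ℝ) := by
  rw [polyCost, Nat.cast_sub (Nat.one_le_pow _ _ (by omega))]
  push_cast
  exact div_mul_cancel₀ _ (pow_cast_sub_one_pos hq hd).ne'

lemma polyCost_pow_four_le {q k : ℕ} (hq : 1 < q) (hk : k ≠ 0)
    (h : (2 * q ^ k) ^ 4 ≤ q ^ k * (q ^ k - 1) ^ 4) : polyCost q k ^ 4 ≤ (q : ℝ) ^ k := by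
  have hpos : (0 : ℝ) < ((q ^ k - 1 : ℕ) : ℝ) := by
    exact_mod_cast Nat.sub_pos_of_lt (Nat.one_lt_pow hk hq)
  have h1 : (((2 * q ^ k : ℕ) : ℝ)) ^ 4 ≤ (q : ℝ) ^ k * ((q ^ k - 1 : ℕ) : ℝ) ^ 4 := by
    exact_mod_cast h
  rw [← polyCost_mul_cast hq hk, mul_pow] at h1
  exact le_of_mul_le_mul_right h1 (by positivity)

lemma NatCoreBound.coreBound {q k n : ℕ} (hq : 1 < q) (hk : k ≠ 0) (h : NatCoreBound q k n) :
    CoreBound q k n := by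
  have hpos : ∀ d, d ≠ 0 → (0 : ℝ) < ((q ^ d - 1 : ℕ) : ℝ) := fun d hd ↦ by
    exact_mod_cast Nat.sub_pos_of_lt (Nat.one_lt_pow hd hq)
  have hc : ∀ d, d ≠ 0 → 0 < polyCost q d := fun d hd ↦
    zero_lt_one.trans_le (one_le_polyCost hq hd)
  have hR := (Nat.cast_le (α := ℝ)).2 h
  simp only [Nat.cast_mul (27 ^ (4 * k)), Nat.cast_mul (q ^ (k * (n - 8))), Nat.cast_pow _ 4,
    Nat.cast_mul (_ ^ (n - 2)), Nat.cast_pow _ (n - 2), Nat.cast_prod] at hR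
  rw [← polyCost_mul_cast hq hk] at hR
  have h1 : ∏ d ∈ Finset.Ico 1 k,
      ((((2 * q ^ d) ^ k * (q ^ k - 1) ^ d) ^ ((q ^ d - 1) / d) : ℕ) : ℝ)
      = (∏ d ∈ Finset.Ico 1 k, (polyCost q d ^ k / polyCost q k ^ d) ^ ((q ^ d - 1) / d)) *
        ∏ d ∈ Finset.Ico 1 k,
          ((((q ^ d - 1) ^ k * (2 * q ^ k) ^ d) ^ ((q ^ d - 1) / d) : ℕ) : ℝ) := by
    rw [← Finset.prod_mul_distrib]
    refine Finset.prod_congr rfl fun d hd ↦ ?_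
    have hd0 : d ≠ 0 := by have := Finset.mem_Ico.1 hd; omega
    have h2 := hc k hk
    rw [Nat.cast_pow, Nat.cast_pow, ← mul_pow, Nat.cast_mul, Nat.cast_mul, Nat.cast_pow,
      Nat.cast_pow, Nat.cast_pow, Nat.cast_pow, ← polyCost_mul_cast hq hd0,
      ← polyCost_mul_cast hq hk]
    congr 1
    field_simp
    ring
  rw [h1] at hR
  set Y := ∏ d ∈ Finset.Ico 1 k,
    ((((q ^ d - 1) ^ k * (2 * q ^ k) ^ d) ^ ((q ^ d - 1) / d) : ℕ) : ℝ) with hY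
  have hY0 : 0 < Y := Finset.prod_pos fun d hd ↦ by
    have hd0 : d ≠ 0 := by have := Finset.mem_Ico.1 hd; omega
    have h3 := Nat.sub_pos_of_lt (Nat.one_lt_pow hd0 hq)
    have h4 : 0 < q := by omega
    exact_mod_cast (by positivity : 0 < ((q ^ d - 1) ^ k * (2 * q ^ k) ^ d) ^ ((q ^ d - 1) / d))
  set x := ((q ^ k - 1 : ℕ) : ℝ)
  have hx : 0 < x := hpos k hk
  have hxY : 0 < (x ^ (n - 2) * Y) ^ 4 := by positivity
  unfold CoreBound
  refine le_of_mul_le_mul_right ?_ hxY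
  push_cast at hR
  refine le_trans (le_of_eq ?_) hR
  rw [mul_pow _ x]
  ring

lemma coreBound_of_lt {q n : ℕ} (hq : 1 < q) (hq46 : q < 47)
    (hn : (if q = 2 then 152 else if q < 8 then 110 else 62) ≤ n) :
    CoreBound q (if q = 2 then 7 else if q < 7 then 4 else 2) n := by
  have key : ∀ q ∈ Finset.Ico 2 47,
      (2 * q ^ (if q = 2 then 7 else if q < 7 then 4 else 2)) ^ 4 ≤
        q ^ (if q = 2 then 7 else if q < 7 then 4 else 2) *
          (q ^ (if q = 2 then 7 else if q < 7 then 4 else 2) - 1) ^ 4 ∧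
      NatCoreBound q (if q = 2 then 7 else if q < 7 then 4 else 2)
        (if q = 2 then 152 else if q < 8 then 110 else 62) := by decide +kernel
  obtain ⟨h1, h2⟩ := key q (Finset.mem_Ico.2 ⟨hq, hq46⟩)
  have hk : (if q = 2 then 7 else if q < 7 then 4 else 2) ≠ 0 := by split_ifs <;> norm_num
  exact (h2.coreBound hq hk).mono hq hk (polyCost_pow_four_le hq hk h1)
    (by split_ifs <;> norm_num) hn

lemma one_add_two_div_pow_le {m : ℕ} (hm : m ≠ 0) : (1 + 2 / (m : ℝ)) ^ m ≤ 739 / 100 := by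
  have hm' : (m : ℝ) ≠ 0 := by exact_mod_cast hm
  calc (1 + 2 / (m : ℝ)) ^ m ≤ Real.exp (2 / m) ^ m :=
        pow_le_pow_left₀ (by positivity) (by rw [add_comm]; exact Real.add_one_le_exp _) m
    _ = Real.exp 1 ^ 2 := by
        rw [← Real.exp_nat_mul, ← Real.exp_nat_mul]
        congr 1; push_cast; field_simp
    _ ≤ 2.7182818286 ^ 2 := pow_le_pow_left₀ (Real.exp_pos 1).le Real.exp_one_lt_d9.le 2
    _ ≤ 739 / 100 := by norm_num

lemma coreBound_two_of_le {q n : ℕ} (hq : 47 ≤ q) (hqn : q ≤ n) : CoreBound q 2 n := by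
  have hq' : (47 : ℝ) ≤ q := by exact_mod_cast hq
  have h1 : polyCost q 1 ^ 2 / polyCost q 2 ^ 1 = 2 * (1 + 2 / ((q - 1 : ℕ) : ℝ)) := by
    have h2 : (q : ℝ) - 1 ≠ 0 := by linarith
    have h3 : (q : ℝ) + 1 ≠ 0 := by linarith
    have h5 : (q : ℝ) ≠ 0 := by linarith
    have h4 : (q : ℝ) ^ 2 - 1 = (q - 1) * (q + 1) := by ring
    rw [polyCost, polyCost, Nat.cast_sub (by omega), Nat.cast_one, pow_one, pow_one, h4]
    field_simp
    ring
  have h2 : polyCost q 2 ≤ 2001 / 1000 := by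
    rw [polyCost, div_le_div_iff₀ (by nlinarith) (by norm_num)]
    nlinarith
  have h20 : 0 < polyCost q 2 := zero_lt_one.trans_le (one_le_polyCost (by omega) two_ne_zero)
  have h3 : polyCost q 2 ^ (n - 2) * ∏ d ∈ Finset.Ico 1 2,
      (polyCost q d ^ 2 / polyCost q 2 ^ d) ^ ((q ^ d - 1) / d)
      ≤ (2001 / 1000) ^ (n - 2) * (2 ^ (n - 1) * (739 / 100)) := by
    rw [show Finset.Ico 1 2 = {1} from rfl, Finset.prod_singleton, h1, pow_one q, Nat.div_one,
      mul_pow]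
    refine mul_le_mul (pow_le_pow_left₀ h20.le h2 _) (mul_le_mul (pow_le_pow_right₀ one_le_two
      (by omega)) (one_add_two_div_pow_le (by omega)) (by positivity) (by positivity))
      (by positivity) (by positivity)
  obtain ⟨m, rfl⟩ := Nat.exists_eq_add_of_le (hq.trans hqn)
  have h4 : (27 : ℝ) ^ (4 * 2) *
      ((2001 / 1000) ^ (47 + m - 2) * (2 ^ (47 + m - 1) * (739 / 100))) ^ 4
      ≤ 47 ^ (2 * (47 + m - 8)) := by
    rw [show 47 + m - 2 = 45 + m by omega, show 47 + m - 1 = 46 + m by omega,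
      show 2 * (47 + m - 8) = 78 + 2 * m by omega, pow_add _ 45, pow_add _ 46, pow_add _ 78,
      pow_mul (47 : ℝ) 2]
    have h5 : ((2001 / 1000 * 2 : ℝ) ^ 4) ^ m ≤ (47 ^ 2) ^ m :=
      pow_le_pow_left₀ (by positivity) (by norm_num) m
    have h6 : (27 : ℝ) ^ (4 * 2) * ((2001 / 1000) ^ 45 * (2 ^ 46 * (739 / 100))) ^ 4
        ≤ 47 ^ 78 := by norm_num
    refine le_trans (le_of_eq ?_) (mul_le_mul h6 h5 (by positivity) (by positivity))
    rw [pow_right_comm, mul_pow _ (2 : ℝ) m]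
    ring
  unfold CoreBound
  refine (mul_le_mul_of_nonneg_left (pow_le_pow_left₀ ?_ h3 4) (by positivity)).trans (h4.trans
    (pow_le_pow_left₀ (by norm_num) hq' _))
  refine mul_nonneg (by positivity) (Finset.prod_nonneg fun d hd ↦ ?_)
  have hd0 : d ≠ 0 := by have := Finset.mem_Ico.1 hd; omega
  have := one_le_polyCost (q := q) (by omega) hd0
  positivity

section Criterion

variable {K E : Type*} [Field K] [Fintype K] [Field E] [Fintype E] [Algebra K E]

lemma prod_primeCost_mul_sqrt_pow_four_lt :
    ((∏ p ∈ (Fintype.card E - 1).primeFactors, primeCost p) * √(Fintype.card E : ℝ)) ^ 4 <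
      27 ^ 4 * (Fintype.card E : ℝ) ^ 3 := by
  have hE : 1 < Fintype.card E := Fintype.one_lt_card
  have h1 := prod_primeCost_pow_four_le (m := Fintype.card E - 1) (by omega)
  have h2 : ((Fintype.card E - 1 : ℕ) : ℝ) < Fintype.card E := by
    exact_mod_cast Nat.sub_lt (by omega) one_pos
  have h3 : (0 : ℝ) < Fintype.card E := by exact_mod_cast (by omega : 0 < Fintype.card E)
  rw [mul_pow, show √(Fintype.card E : ℝ) ^ 4 = (√(Fintype.card E : ℝ) ^ 2) ^ 2 by ring,
    Real.sq_sqrt h3.le]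
  calc _ ≤ 27 ^ 4 * ((Fintype.card E - 1 : ℕ) : ℝ) * (Fintype.card E : ℝ) ^ 2 :=
        mul_le_mul_of_nonneg_right h1 (by positivity)
    _ < 27 ^ 4 * (Fintype.card E : ℝ) * (Fintype.card E : ℝ) ^ 2 := by gcongr
    _ = _ := by ring

lemma exists_primitive_kNormal_of_coreBound {h f : K[X]}
    (hhf : h * f = X ^ Module.finrank K E - 1) (hdeg : h.natDegree = Module.finrank K E - 2)
    (hn : 8 ≤ Module.finrank K E) {k : ℕ} (hk : 1 ≤ k)
    (hlt : CoreBound (Fintype.card K) k (Module.finrank K E)) :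
    ∃ α : E, IsPrimitiveElem α ∧
      IsKNormal (Fintype.card K) (Module.finrank K E) f.natDegree α := by
  have hq : 1 < Fintype.card K := Fintype.one_lt_card
  refine exists_primitive_kNormal_of_pow_bound hhf hk (fun d ↦ (Fintype.card K ^ d - 1) / d)
    (fun d hd _ ↦ ?_) ?_
  · rw [Nat.le_div_iff_mul_le hd]
    exact (card_filter_normalizedFactors_mul_le (ne_zero_of_mul_eq_X_pow_finrank_sub_one hhf)
      (by omega) (Dvd.intro _ hhf) (by omega)).trans
      (Nat.gcd_le_right _ (Nat.sub_pos_of_lt (Nat.one_lt_pow (by omega) hq)))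
  · have hY := prod_primeCost_mul_sqrt_pow_four_lt (E := E)
    rw [hdeg]
    unfold CoreBound at hlt
    set Y := (∏ p ∈ (Fintype.card E - 1).primeFactors, primeCost p) * √(Fintype.card E : ℝ)
    set Z := polyCost (Fintype.card K) k ^ (Module.finrank K E - 2) * ∏ d ∈ Finset.Ico 1 k,
      (polyCost (Fintype.card K) d ^ k / polyCost (Fintype.card K) k ^ d) ^
        ((Fintype.card K ^ d - 1) / d) with hZ
    have hc : ∀ d, d ≠ 0 → 0 < polyCost (Fintype.card K) d := fun d hd ↦
      zero_lt_one.trans_le (one_le_polyCost hq hd)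
    have hZ0 : 0 < Z := by
      refine mul_pos (pow_pos (hc k (by omega)) _) (Finset.prod_pos fun d hd ↦ ?_)
      have h1 := hc d (by have := Finset.mem_Ico.1 hd; omega)
      have h2 := hc k (by omega)
      positivity
    refine lt_of_pow_lt_pow_left₀ 4 (by positivity) ?_
    have hq0 : (0 : ℝ) < Fintype.card K := by exact_mod_cast (by omega : 0 < Fintype.card K)
    rw [Module.card_eq_pow_finrank (K := K) (V := E), Nat.cast_pow] at hY
    calc (Y ^ k * Z) ^ 4 = (Y ^ 4) ^ k * Z ^ 4 := by ring
      _ < (27 ^ 4 * ((Fintype.card K : ℝ) ^ Module.finrank K E) ^ 3) ^ k * Z ^ 4 :=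
        mul_lt_mul_of_pos_right (pow_lt_pow_left₀ hY (by positivity) (by omega)) (by positivity)
      _ = (27 ^ (4 * k) * Z ^ 4) * (Fintype.card K : ℝ) ^ (k * (3 * Module.finrank K E)) := by
        rw [mul_pow, ← pow_mul, ← pow_mul, ← pow_mul]; ring_nf
      _ ≤ (Fintype.card K : ℝ) ^ (k * (Module.finrank K E - 8)) *
          (Fintype.card K : ℝ) ^ (k * (3 * Module.finrank K E)) :=
        mul_le_mul_of_nonneg_right hlt (by positivity)
      _ = _ := by
        rw [← pow_add, ← mul_add, ← pow_mul, ← pow_mul]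
        congr 1
        obtain ⟨m, hm⟩ := Nat.exists_eq_add_of_le hn
        rw [hm, show 8 + m - 8 = m by omega, show 8 + m - 2 = 6 + m by omega]
        ring

lemma exists_primitive_kNormal_of_finrank_lt_card {h f : K[X]}
    (hhf : h * f = X ^ Module.finrank K E - 1) (hdeg : h.natDegree = Module.finrank K E - 2)
    (hn : 19 ≤ Module.finrank K E) (hnq : Module.finrank K E < Fintype.card K) :
    ∃ α : E, IsPrimitiveElem α ∧
      IsKNormal (Fintype.card K) (Module.finrank K E) f.natDegree α := by
  have hq0 : (0 : ℝ) < Fintype.card K := by exact_mod_cast (by omega : 0 < Fintype.card K)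
  have hh := ne_zero_of_mul_eq_X_pow_finrank_sub_one hhf
  refine exists_primitive_kNormal_of_bounds hhf (k := 1) (l := 1) (s := 0) (σ := 0)
    (r := Module.finrank K E - 2) le_rfl le_rfl (fun _ ↦ 0) ?_ (fun d h1 h2 ↦ by omega)
    (Fintype.card E - 1).primeFactors subset_rfl (by simp) (by simp) ?_
  · rw [← hdeg]
    exact sum_natDegree_normalizedFactors_le hh hh fun g _ hg ↦ hg
  · have hY := prod_primeCost_mul_sqrt_pow_four_lt (E := E)
    rw [hdeg]
    simp only [Finset.Ico_self, Finset.prod_empty, Finset.sum_empty, mul_one, Nat.cast_zero,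
      zero_add, add_zero, Nat.div_one, pow_one]
    rw [mul_right_comm]
    set Y := (∏ p ∈ (Fintype.card E - 1).primeFactors, primeCost p) * √(Fintype.card E : ℝ)
    rw [Module.card_eq_pow_finrank (K := K) (V := E), Nat.cast_pow] at hY
    set n := Module.finrank K E
    set q := (Fintype.card K : ℝ) with hq
    have h20 : (20 : ℝ) ≤ q := by rw [hq]; exact_mod_cast (by omega : 20 ≤ Fintype.card K)
    have h1 : (3 : ℝ) / q ≤ 1 - ((n - 2 : ℕ) : ℝ) * (1 / q) := by
      have h2 : ((n - 2 : ℕ) : ℝ) + 3 ≤ q := by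
        rw [hq]; exact_mod_cast (by omega : n - 2 + 3 ≤ Fintype.card K)
      rw [div_le_iff₀ hq0, sub_mul, mul_assoc, one_div_mul_cancel hq0.ne']
      linarith
    refine lt_of_lt_of_le ?_ (mul_le_mul_of_nonneg_left h1 (by positivity))
    have h3 : ((n - 2 : ℕ) : ℝ) + 1 ≤ q := by
      rw [hq]; exact_mod_cast (by omega : n - 2 + 1 ≤ Fintype.card K)
    refine lt_of_pow_lt_pow_left₀ 4 (by positivity) ?_
    obtain ⟨m, hm⟩ := Nat.exists_eq_add_of_le hn
    calc (Y * (((n - 2 : ℕ) : ℝ) + 1)) ^ 4 = Y ^ 4 * (((n - 2 : ℕ) : ℝ) + 1) ^ 4 := mul_pow _ _ _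
      _ < 27 ^ 4 * (q ^ n) ^ 3 * q ^ 4 :=
        mul_lt_mul hY (pow_le_pow_left₀ (by positivity) h3 4) (by positivity) (by positivity)
      _ = 3 ^ 4 * 9 ^ 4 * (q ^ n) ^ 3 * q ^ 4 := by norm_num
      _ ≤ 3 ^ 4 * q ^ (3 + m) * (q ^ n) ^ 3 * q ^ 4 := by
        gcongr
        calc (9 : ℝ) ^ 4 ≤ 20 ^ 3 := by norm_num
          _ ≤ q ^ 3 := pow_le_pow_left₀ (by norm_num) h20 3
          _ ≤ q ^ (3 + m) := pow_le_pow_right₀ (by linarith) (by omega)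
      _ = (q ^ (n - 2) * (3 / q)) ^ 4 := by
        rw [hm, show 19 + m - 2 = 16 + m + 1 by omega, pow_succ]
        field_simp
        ring

end Criterion

/-- For every natural number `n ≥ 19` and every prime power `q` with
`gcd(q^3 - q, n) ≠ 1`, there exists a primitive `2`-normal element in `F_{q^n}`. -/
theorem primitive_two_normal_large_n (n : ℕ) (hn : 19 ≤ n)
    (q : ℕ) (hq : IsPrimePow q) (hgcd : Nat.gcd (q ^ 3 - q) n ≠ 1)
    (E : Type*) [Field E] [Fintype E] (hE : Fintype.card E = q ^ n) :
    ∃ α : E, IsPrimitiveElem α ∧ IsKNormal q n 2 α := by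
  obtain ⟨K, _, _, _, rfl, rfl⟩ := exists_subfield_of_card hq E hE
  obtain ⟨f, hf, hf2, h, hfh⟩ := exists_monic_quadratic_dvd (K := K) hgcd
  have hhf : h * f = X ^ Module.finrank K E - 1 := by rw [hfh, mul_comm]
  have hdeg : h.natDegree = Module.finrank K E - 2 := by
    have h1 := congrArg natDegree hhf
    rw [mul_comm, hf.natDegree_mul' (ne_zero_of_mul_eq_X_pow_finrank_sub_one hhf), hf2,
      show (X ^ Module.finrank K E - 1 : K[X]).natDegree = Module.finrank K E from
        natDegree_X_pow_sub_C (r := 1)] at h1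
    omega
  have hq1 : 1 < Fintype.card K := Fintype.one_lt_card
  rw [← hf2]
  rcases lt_or_ge (Module.finrank K E) (Fintype.card K) with hnq | hqn
  · exact exists_primitive_kNormal_of_finrank_lt_card hhf hdeg hn hnq
  rcases le_or_gt 47 (Fintype.card K) with hq47 | hq46
  · exact exists_primitive_kNormal_of_coreBound hhf hdeg (by omega) one_le_two
      (coreBound_two_of_le hq47 hqn)
  rcases le_or_gt (if Fintype.card K = 2 then 152 else if Fintype.card K < 8 then 110 else 62)
    (Module.finrank K E) with hn' | hn'
  · exact exists_primitive_kNormal_of_coreBound hhf hdeg (by omega)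
      (by split_ifs <;> norm_num) (coreBound_of_lt hq1 hq46 hn')
  by_cases h20 : Fintype.card K = 2 ∧ Module.finrank K E = 20
  · exact exists_primitive_kNormal_of_card_eq_two_of_finrank_eq_twenty hhf hdeg h20.1 h20.2
  by_cases h24 : Fintype.card K = 2 ∧ Module.finrank K E = 24
  · exact exists_primitive_kNormal_of_card_eq_two_of_finrank_eq_twentyFour hhf hdeg h24.1 h24.2
  rcases smallSieveBound_of_lt hq1 hq46 hn hqn hn' hgcd h20 h24 with hS | hS
  · exact exists_primitive_kNormal_of_smallSieveBound hhf hdeg (by omega) (by norm_num)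
      (by norm_num) hS
  · exact exists_primitive_kNormal_of_smallSieveBound hhf hdeg (by omega) (by norm_num)
      (by norm_num) hS

end
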